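/- arXiv:2404.11282 — 5 statements merged into one kernel-verified Lean document; each statement's English description precedes it below -/
import Mathlib

section
/- Let ⋆ be a bilinear product on ℝⁿ with structure constants a_{ij}^k in the standard basis, and let R be its right-adjoint operator, the linear operator field with entries (R(x))^k_i = a_{ij}^k x^j. Then the algebra (ℝⁿ,⋆) is left-symmetric if and only if R is a Nijenhuis operator, i.e. the Nijenhuis torsion of R vanishes identically on ℝⁿ. -/
open Matrix

/-- Components `N^i_{jk}` of the Nijenhuis torsion of a matrix-valued operator
field `L` on `ℝⁿ` (with `L x i j = L^i_j(x)`). -/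
noncomputable def nijTorsion {n : ℕ} (L : (Fin n → ℝ) → Matrix (Fin n) (Fin n) ℝ)
    (x : Fin n → ℝ) (i j k : Fin n) : ℝ :=
  ∑ s : Fin n,
    (L x s j * fderiv ℝ (fun y => L y i k) x (Pi.single s 1)
      - L x s k * fderiv ℝ (fun y => L y i j) x (Pi.single s 1)
      - L x i s * fderiv ℝ (fun y => L y s k) x (Pi.single j 1)
      + L x i s * fderiv ℝ (fun y => L y s j) x (Pi.single k 1))

/-- `L` is a Nijenhuis operator: its Nijenhuis torsion vanishes identically. -/
def IsNijenhuis {n : ℕ} (L : (Fin n → ℝ) → Matrix (Fin n) (Fin n) ℝ) : Prop :=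
  ∀ x i j k, nijTorsion L x i j k = 0

/-- Bilinear product on `ℝⁿ` with structure constants `a i j k`
(`ηᵢ ⋆ ηⱼ = ∑ₖ a i j k • ηₖ`). -/
def mulSC {n : ℕ} (a : Fin n → Fin n → Fin n → ℝ) (ξ η : Fin n → ℝ) : Fin n → ℝ :=
  fun k => ∑ i : Fin n, ∑ j : Fin n, a i j k * ξ i * η j

/-- Left-symmetry: the associator is symmetric in its first two arguments. -/
def IsLSA {n : ℕ} (a : Fin n → Fin n → Fin n → ℝ) : Prop :=
  ∀ ξ η ζ : Fin n → ℝ,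
    mulSC a (mulSC a ξ η) ζ - mulSC a ξ (mulSC a η ζ)
      = mulSC a (mulSC a η ξ) ζ - mulSC a η (mulSC a ξ ζ)

/-- The right-adjoint operator field of the algebra with structure constants `a`:
`(R x) k i = ∑ j, a i j k * x j`, i.e. `(R x).mulVec ξ = ξ ⋆ x`. -/
def rightAdj {n : ℕ} (a : Fin n → Fin n → Fin n → ℝ) (x : Fin n → ℝ) :
    Matrix (Fin n) (Fin n) ℝ :=
  Matrix.of fun k i => ∑ j : Fin n, a i j k * x j

/-- `charCoeff L i` is the coefficient `σ_{i+1}` of `t^(n-1-i)` in the characteristic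
polynomial `χ_{L(x)}(t) = tⁿ + σ₁(x) tⁿ⁻¹ + ⋯ + σₙ(x)` of `L(x)`. -/
noncomputable def charCoeff {n : ℕ} (L : (Fin n → ℝ) → Matrix (Fin n) (Fin n) ℝ)
    (i : Fin n) : (Fin n → ℝ) → ℝ :=
  fun x => (L x).charpoly.coeff (n - 1 - (i : ℕ))

/-- A (structure-constant) algebra is differentially non-degenerate if the coefficients
of the characteristic polynomial of its right-adjoint operator are algebraically
independent over `ℝ` (as elements of the algebra of real-valued functions). -/
def DiffNonDeg {n : ℕ} (a : Fin n → Fin n → Fin n → ℝ) : Prop :=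
  AlgebraicIndependent ℝ (charCoeff (rightAdj a))

/-- Isomorphism of the algebras on `ℝⁿ` with structure constants `a` and `b`. -/
def AlgIsoSC {n : ℕ} (a b : Fin n → Fin n → Fin n → ℝ) : Prop :=
  ∃ φ : (Fin n → ℝ) ≃ₗ[ℝ] (Fin n → ℝ),
    ∀ ξ η : Fin n → ℝ, φ (mulSC a ξ η) = mulSC b (φ ξ) (φ η)

/-- Jacobi matrix of a family of functions `σ` on `ℝⁿ`: `J i j = ∂σᵢ/∂xⱼ`. -/
noncomputable def jacobiMat {n : ℕ} (σ : Fin n → (Fin n → ℝ) → ℝ) (x : Fin n → ℝ) :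
    Matrix (Fin n) (Fin n) ℝ :=
  Matrix.of fun i j => fderiv ℝ (σ i) x (Pi.single j 1)

/-- Companion-type matrix with first column `(-s 0, …, -s (n-1))ᵀ`, ones on the
superdiagonal and zeros elsewhere. -/
def companionS {n : ℕ} (s : Fin n → ℝ) : Matrix (Fin n) (Fin n) ℝ :=
  Matrix.of fun i j => if (j : ℕ) = 0 then -s i else if (j : ℕ) = (i : ℕ) + 1 then 1 else 0

/-- The product `mulSC a` as a bilinear map. -/
def mulSCBilin {n : ℕ} (a : Fin n → Fin n → Fin n → ℝ) :
    (Fin n → ℝ) →ₗ[ℝ] (Fin n → ℝ) →ₗ[ℝ] (Fin n → ℝ) :=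
  LinearMap.mk₂ ℝ (mulSC a)
    (fun ξ ξ' η => by
      ext k; simp only [mulSC, Pi.add_apply, mul_add, add_mul, Finset.sum_add_distrib])
    (fun c ξ η => by
      ext k
      simp only [mulSC, Pi.smul_apply, smul_eq_mul, Finset.mul_sum]
      exact Finset.sum_congr rfl fun i _ => Finset.sum_congr rfl fun j _ => by ring)
    (fun ξ η η' => by
      ext k; simp only [mulSC, Pi.add_apply, mul_add, Finset.sum_add_distrib])
    (fun c ξ η => by
      ext k
      simp only [mulSC, Pi.smul_apply, smul_eq_mul, Finset.mul_sum]
      exact Finset.sum_congr rfl fun i _ => Finset.sum_congr rfl fun j _ => by ring)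

/-- The antisymmetrization of the associator in its first two arguments. -/
def assocSkew {n : ℕ} (a : Fin n → Fin n → Fin n → ℝ) (ξ η ζ : Fin n → ℝ) : Fin n → ℝ :=
  (mulSC a (mulSC a ξ η) ζ - mulSC a ξ (mulSC a η ζ))
    - (mulSC a (mulSC a η ξ) ζ - mulSC a η (mulSC a ξ ζ))

/-- `assocSkew` as a bilinear map in its first two arguments. -/
def assocSkewBilin {n : ℕ} (a : Fin n → Fin n → Fin n → ℝ) (ζ : Fin n → ℝ) :
    (Fin n → ℝ) →ₗ[ℝ] (Fin n → ℝ) →ₗ[ℝ] (Fin n → ℝ) :=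
  let B := mulSCBilin a
  let D : (Fin n → ℝ) →ₗ[ℝ] (Fin n → ℝ) →ₗ[ℝ] (Fin n → ℝ) :=
    B.compr₂ (B.flip ζ) - B.compl₂ (B.flip ζ)
  D - D.flip

theorem assocSkewBilin_apply {n : ℕ} (a : Fin n → Fin n → Fin n → ℝ) (ξ η ζ : Fin n → ℝ) :
    assocSkewBilin a ζ ξ η = assocSkew a ξ η ζ := rfl

theorem isLSA_iff_assocSkew_single {n : ℕ} (a : Fin n → Fin n → Fin n → ℝ) :
    IsLSA a ↔ ∀ x j k, assocSkew a (Pi.single j 1) (Pi.single k 1) x = 0 := by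
  constructor
  · intro h x j k
    exact sub_eq_zero.mpr (h _ _ _)
  · intro h ξ η ζ
    have h0 : assocSkewBilin a ζ = 0 := by
      refine (Pi.basisFun ℝ (Fin n)).ext fun j => (Pi.basisFun ℝ (Fin n)).ext fun k => ?_
      simpa only [Pi.basisFun_apply, assocSkewBilin_apply, LinearMap.zero_apply] using h ζ j k
    refine sub_eq_zero.mp ?_
    change assocSkewBilin a ζ ξ η = 0
    rw [h0]; rfl

theorem rightAdj_apply {n : ℕ} (a : Fin n → Fin n → Fin n → ℝ) (x : Fin n → ℝ) (i k : Fin n) :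
    rightAdj a x i k = mulSC a (Pi.single k 1) x i := by
  simp [rightAdj, mulSC, Pi.single_apply]

theorem fderiv_rightAdj {n : ℕ} (a : Fin n → Fin n → Fin n → ℝ) (x v : Fin n → ℝ)
    (i k : Fin n) :
    fderiv ℝ (fun y => rightAdj a y i k) x v = mulSC a (Pi.single k 1) v i := by
  let f : (Fin n → ℝ) →L[ℝ] ℝ :=
    LinearMap.toContinuousLinearMap (LinearMap.proj i ∘ₗ mulSCBilin a (Pi.single k 1))
  have hf : (fun y => rightAdj a y i k) = f := funext fun y => rightAdj_apply a y i k
  rw [hf, f.fderiv]; rfl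

theorem mulSC_eq_sum_left {n : ℕ} (a : Fin n → Fin n → Fin n → ℝ) (ξ η : Fin n → ℝ)
    (i : Fin n) : mulSC a ξ η i = ∑ s, ξ s * mulSC a (Pi.single s 1) η i := by
  simp only [← rightAdj_apply]
  simp only [rightAdj, of_apply, mulSC, Finset.mul_sum]
  exact Finset.sum_congr rfl fun s _ => Finset.sum_congr rfl fun j _ => by ring

theorem mulSC_eq_sum_right {n : ℕ} (a : Fin n → Fin n → Fin n → ℝ) (ξ η : Fin n → ℝ)
    (i : Fin n) : mulSC a ξ η i = ∑ s, η s * mulSC a ξ (Pi.single s 1) i := by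
  rw [mulSC, Finset.sum_comm]
  refine Finset.sum_congr rfl fun s _ => ?_
  simp only [mulSC, Pi.single_apply, mul_ite, mul_one, mul_zero, Finset.sum_ite_eq',
    Finset.mem_univ, if_true, Finset.mul_sum]
  exact Finset.sum_congr rfl fun j _ => by ring

theorem nijTorsion_rightAdj {n : ℕ} (a : Fin n → Fin n → Fin n → ℝ) (x : Fin n → ℝ)
    (i j k : Fin n) :
    nijTorsion (rightAdj a) x i j k = assocSkew a (Pi.single j 1) (Pi.single k 1) x i := by
  simp only [nijTorsion, fderiv_rightAdj]
  simp only [rightAdj_apply, assocSkew, Pi.sub_apply,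
    Finset.sum_add_distrib, Finset.sum_sub_distrib]
  rw [mulSC_eq_sum_left a (mulSC a (Pi.single j 1) (Pi.single k 1)),
    mulSC_eq_sum_left a (mulSC a (Pi.single k 1) (Pi.single j 1)),
    mulSC_eq_sum_right a (Pi.single j 1) (mulSC a (Pi.single k 1) x),
    mulSC_eq_sum_right a (Pi.single k 1) (mulSC a (Pi.single j 1) x)]
  simp only [mul_comm (mulSC a (Pi.single _ 1) x i)]
  ring

/-- An `n`-dimensional real algebra is left-symmetric if and only if its
right-adjoint operator is a Nijenhuis operator. -/
theorem stmt0 (n : ℕ) (a : Fin n → Fin n → Fin n → ℝ) :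
    IsLSA a ↔ IsNijenhuis (rightAdj a) := by
  simp only [isLSA_iff_assocSkew_single, IsNijenhuis, nijTorsion_rightAdj, funext_iff,
    Pi.zero_apply]
  exact forall_congr' fun x => ⟨fun h i j k => h j k i, fun h j k i => h i j k⟩
end

section
/- Let L : ℝⁿ → Mat(n,ℝ) be a Nijenhuis operator with smooth entries, let σ₁(x),…,σ_n(x) be the coefficients of its characteristic polynomial χ_{L(x)}(t) = tⁿ + σ₁(x)tⁿ⁻¹ + ⋯ + σ_n(x), and let J(x) be the Jacobi matrix of (σ₁,…,σ_n) with respect to the coordinates x₁,…,x_n. Then for all x the matrix relation J(x)·L(x) = S_χ(x)·J(x) holds, where S_χ(x) is the companion-type matrix with first column (−σ₁(x),…,−σ_n(x))ᵀ, ones on the superdiagonal, and zeros elsewhere. -/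
open Matrix

/-- The Jacobi formula for the derivative of a determinant. -/
theorem HasFDerivAt.matrix_det {E ι : Type*} [NormedAddCommGroup E] [NormedSpace ℝ E]
    [Fintype ι] [DecidableEq ι] {M : E → Matrix ι ι ℝ} {M' : ι → ι → E →L[ℝ] ℝ} {x : E}
    (h : ∀ i j, HasFDerivAt (fun y => M y i j) (M' i j) x) :
    HasFDerivAt (fun y => (M y).det) (∑ i, ∑ j, (M x).adjugate i j • M' j i) x := by
  have hdet : HasFDerivAt (fun y => (M y).det)
      (∑ τ : Equiv.Perm ι, (Equiv.Perm.sign τ : ℝ) •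
        ∑ i, (∏ j ∈ Finset.univ.erase i, M x (τ j) j) • M' (τ i) i) x := by
    simp only [det_apply']
    exact HasFDerivAt.fun_sum fun τ _ =>
      (HasFDerivAt.finsetProd fun i _ => h (τ i) i).const_mul _
  refine hdet.congr_fderiv (ContinuousLinearMap.ext fun v => ?_)
  have hcol (i : ι) : ∑ j, (M x).adjugate i j * M' j i v
      = ((M x).updateCol i fun j => M' j i v).det := by
    rw [← cramer_apply, cramer_eq_adjugate_mulVec]
    rfl
  simp only [_root_.sum_apply, _root_.smul_apply, smul_eq_mul, hcol, det_apply']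
  rw [Finset.sum_comm]
  refine Finset.sum_congr rfl fun τ _ => ?_
  rw [Finset.mul_sum]
  refine Finset.sum_congr rfl fun i _ => ?_
  rw [← Finset.mul_prod_erase Finset.univ _ (Finset.mem_univ i), updateCol_self,
    mul_comm (M' _ _ _)]
  congr 2
  refine Finset.prod_congr rfl fun j hj => ?_
  rw [updateCol_ne (Finset.ne_of_mem_erase hj)]

/-- The entrywise derivative of a matrix-valued map at `x` in the direction `v`. -/
noncomputable def matrixDeriv {n : ℕ} (L : (Fin n → ℝ) → Matrix (Fin n) (Fin n) ℝ)
    (x v : Fin n → ℝ) : Matrix (Fin n) (Fin n) ℝ :=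
  Matrix.of fun i j => fderiv ℝ (fun y => L y i j) x v

theorem fderiv_apply_eq_sum {n : ℕ} (f : (Fin n → ℝ) → ℝ) (x v : Fin n → ℝ) :
    fderiv ℝ f x v = ∑ s, v s * fderiv ℝ f x (Pi.single s 1) := by
  conv_lhs => rw [pi_eq_sum_univ' v]
  simp [map_sum]

/-- The vanishing of the Nijenhuis torsion, written as a matrix identity. -/
theorem IsNijenhuis.matrixDeriv_col {n : ℕ} {L : (Fin n → ℝ) → Matrix (Fin n) (Fin n) ℝ}
    (hN : IsNijenhuis L) (x : Fin n → ℝ) (k : Fin n) :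
    ∃ B : Matrix (Fin n) (Fin n) ℝ, matrixDeriv L x ((L x).col k)
      = L x * matrixDeriv L x (Pi.single k 1) + (B * L x - L x * B) := by
  refine ⟨Matrix.of fun i s => fderiv ℝ (fun y => L y i k) x (Pi.single s 1), ?_⟩
  ext i j
  have h := hN x i j k
  simp only [nijTorsion, Finset.sum_add_distrib, Finset.sum_sub_distrib] at h
  simp only [matrixDeriv, Matrix.add_apply, Matrix.sub_apply, Matrix.mul_apply, Matrix.of_apply]
  rw [fderiv_apply_eq_sum]
  simp only [Matrix.col_apply, mul_comm (fderiv ℝ _ _ _)]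
  linarith

theorem Matrix.differentiable_charpoly_coeff {n : ℕ}
    {L : (Fin n → ℝ) → Matrix (Fin n) (Fin n) ℝ}
    (hL : ∀ i j, Differentiable ℝ fun y => L y i j) (m : ℕ) :
    Differentiable ℝ fun y => (L y).charpoly.coeff m := by
  have h (y) : (L y).charpoly.coeff m = MvPolynomial.eval (fun p : Fin n × Fin n => L y p.1 p.2)
      ((charpoly.univ ℝ (Fin n)).coeff m) := by
    have h := charpoly.univ_coeff_eval₂Hom (Fin n) (RingHom.id ℝ) (fun p => L y p.1 p.2) m
    rw [show Matrix.of (Function.curry fun p : Fin n × Fin n => L y p.1 p.2) = L y from rfl] at h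
    rw [← h, MvPolynomial.coe_eval₂Hom, MvPolynomial.eval₂_id]
  simp only [h]
  induction (charpoly.univ ℝ (Fin n)).coeff m using MvPolynomial.induction_on with
  | C a => simp
  | add p q hp hq => simpa using! hp.add hq
  | mul_X p i hp => simpa using! hp.mul (hL i.1 i.2)

theorem Matrix.charpoly_eval_eq_sum {n : ℕ} (A : Matrix (Fin n) (Fin n) ℝ) (t : ℝ) :
    A.charpoly.eval t = ∑ m ∈ Finset.range (n + 1), A.charpoly.coeff m * t ^ m := by
  rw [Polynomial.eval_eq_sum_range, charpoly_natDegree_eq_dim, Fintype.card_fin]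

/-- The derivative of the characteristic polynomial, evaluated at a fixed scalar. -/
theorem sum_fderiv_charpoly_coeff {n : ℕ} {L : (Fin n → ℝ) → Matrix (Fin n) (Fin n) ℝ}
    (hL : ∀ i j, Differentiable ℝ fun y => L y i j) (x v : Fin n → ℝ) (t : ℝ) :
    ∑ m ∈ Finset.range (n + 1), fderiv ℝ (fun y => (L y).charpoly.coeff m) x v * t ^ m
      = -((scalar (Fin n) t - L x).adjugate * matrixDeriv L x v).trace := by
  have h₁ : HasFDerivAt (fun y => (L y).charpoly.eval t)
      (∑ m ∈ Finset.range (n + 1), t ^ m • fderiv ℝ (fun y => (L y).charpoly.coeff m) x) x := by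
    simp only [charpoly_eval_eq_sum]
    exact HasFDerivAt.fun_sum fun m _ =>
      (differentiable_charpoly_coeff hL m x).hasFDerivAt.mul_const _
  have h₂ := HasFDerivAt.matrix_det (M := fun y => scalar (Fin n) t - L y)
    fun i j => ((hL i j x).hasFDerivAt.const_sub (scalar (Fin n) t i j))
  simp only [eval_charpoly] at h₁
  have h := DFunLike.congr_fun (h₁.unique h₂) v
  simpa [Matrix.trace, Matrix.mul_apply, matrixDeriv, mul_comm] using h

/-- The identity `L^* dχ(t) = t dχ(t) + χ(t) d(tr L)` for a Nijenhuis operator `L`. -/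
theorem IsNijenhuis.trace_adjugate_mul {n : ℕ} {L : (Fin n → ℝ) → Matrix (Fin n) (Fin n) ℝ}
    (hN : IsNijenhuis L) (x : Fin n → ℝ) (k : Fin n) (t : ℝ) :
    -((scalar (Fin n) t - L x).adjugate * matrixDeriv L x ((L x).col k)).trace
      = t * -((scalar (Fin n) t - L x).adjugate * matrixDeriv L x (Pi.single k 1)).trace
        + (L x).charpoly.eval t * (matrixDeriv L x (Pi.single k 1)).trace := by
  obtain ⟨B, hB⟩ := hN.matrixDeriv_col x k
  rw [hB, eval_charpoly]
  set A := matrixDeriv L x (Pi.single k 1)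
  set M := scalar (Fin n) t - L x with hM
  have hLM : L x = t • 1 - M := by
    rw [hM, scalar_apply, ← smul_one_eq_diagonal, sub_sub_cancel]
  have hleft : M.adjugate * L x = t • M.adjugate - M.det • 1 := by
    rw [hLM, mul_sub, adjugate_mul, Matrix.mul_smul, mul_one]
  have hright : L x * M.adjugate = t • M.adjugate - M.det • 1 := by
    rw [hLM, sub_mul, mul_adjugate, Matrix.smul_mul, one_mul]
  have hcomm : (M.adjugate * (B * L x - L x * B)).trace = 0 := by
    rw [mul_sub, trace_sub, ← mul_assoc, trace_mul_comm, ← mul_assoc, ← mul_assoc, hleft, hright,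
      sub_self]
  rw [mul_add, trace_add, hcomm, ← mul_assoc, hleft, sub_mul, trace_sub, Matrix.smul_mul,
    Matrix.smul_mul, trace_smul, trace_smul, one_mul, smul_eq_mul, smul_eq_mul]
  ring

theorem fderiv_charpoly_coeff_pred {n : ℕ} {L : (Fin n → ℝ) → Matrix (Fin n) (Fin n) ℝ}
    (hL : ∀ i j, Differentiable ℝ fun y => L y i j) (hn : 0 < n) (x v : Fin n → ℝ) :
    fderiv ℝ (fun y => (L y).charpoly.coeff (n - 1)) x v = -(matrixDeriv L x v).trace := by
  have : Nonempty (Fin n) := ⟨⟨0, hn⟩⟩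
  have h (y) : (L y).charpoly.coeff (n - 1) = -∑ i, L y i i := by
    have := trace_eq_neg_charpoly_coeff (L y)
    rw [Fintype.card_fin] at this
    rw [← neg_eq_iff_eq_neg, ← this]
    rfl
  simp only [h]
  have hd := (HasFDerivAt.fun_sum (u := Finset.univ) fun i _ => (hL i i x).hasFDerivAt).neg
  exact (DFunLike.congr_fun hd.fderiv v).trans (by simp [matrixDeriv, Matrix.trace])

/-- Coefficientwise form of `L^* dχ(t) = t dχ(t) + χ(t) d(tr L)`. -/
theorem IsNijenhuis.fderiv_charpoly_coeff_col {n : ℕ}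
    {L : (Fin n → ℝ) → Matrix (Fin n) (Fin n) ℝ}
    (hL : ∀ i j, Differentiable ℝ fun y => L y i j) (hN : IsNijenhuis L) (x : Fin n → ℝ)
    (k : Fin n) {m : ℕ} (hm : m < n) :
    fderiv ℝ (fun y => (L y).charpoly.coeff m) x ((L x).col k)
      = (if m = 0 then 0 else fderiv ℝ (fun y => (L y).charpoly.coeff (m - 1)) x (Pi.single k 1))
        - (L x).charpoly.coeff m *
          fderiv ℝ (fun y => (L y).charpoly.coeff (n - 1)) x (Pi.single k 1) := by
  let P (v : Fin n → ℝ) : Polynomial ℝ := ∑ m ∈ Finset.range (n + 1),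
    Polynomial.C (fderiv ℝ (fun y => (L y).charpoly.coeff m) x v) * Polynomial.X ^ m
  have hPe (v t) : (P v).eval t
      = -((scalar (Fin n) t - L x).adjugate * matrixDeriv L x v).trace := by
    rw [← sum_fderiv_charpoly_coeff hL]
    simp [P, Polynomial.eval_finsetSum]
  have hPc (v) {m : ℕ} (hm : m < n + 1) :
      (P v).coeff m = fderiv ℝ (fun y => (L y).charpoly.coeff m) x v := by
    simp only [P, Polynomial.finsetSum_coeff, Polynomial.coeff_C_mul_X_pow]
    rw [Finset.sum_ite_eq, if_pos (Finset.mem_range.2 hm)]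
  have hP : P ((L x).col k) = Polynomial.X * P (Pi.single k 1)
      + (L x).charpoly * Polynomial.C (matrixDeriv L x (Pi.single k 1)).trace := by
    refine Polynomial.funext fun t => ?_
    simp only [Polynomial.eval_add, Polynomial.eval_mul, Polynomial.eval_X, Polynomial.eval_C, hPe]
    exact hN.trace_adjugate_mul x k t
  rw [fderiv_charpoly_coeff_pred hL (Nat.zero_lt_of_lt hm), ← hPc _ (by omega : m < n + 1), hP,
    Polynomial.coeff_add, Polynomial.coeff_mul_C, mul_neg, sub_neg_eq_add]
  congr 1
  cases m with
  | zero => simp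
  | succ m => rw [Polynomial.coeff_X_mul, hPc _ (by omega)]; simp

/-- For a Nijenhuis operator `L` with smooth entries, the Jacobi matrix `J` of the
coefficients of its characteristic polynomial satisfies `J(x) L(x) = S_χ(x) J(x)`. -/
theorem stmt1 (n : ℕ) (L : (Fin n → ℝ) → Matrix (Fin n) (Fin n) ℝ)
    (hsmooth : ∀ i j : Fin n, ContDiff ℝ (⊤ : ℕ∞) fun x => L x i j)
    (hN : IsNijenhuis L) (x : Fin n → ℝ) :
    jacobiMat (charCoeff L) x * L x
      = companionS (fun i => charCoeff L i x) * jacobiMat (charCoeff L) x := by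
  have hL (i j : Fin n) : Differentiable ℝ fun y => L y i j :=
    (hsmooth i j).differentiable (by simp)
  ext i k
  have hi := i.isLt
  have hleft : (jacobiMat (charCoeff L) x * L x) i k
      = fderiv ℝ (charCoeff L i) x ((L x).col k) := by
    rw [fderiv_apply_eq_sum]
    simp [Matrix.mul_apply, jacobiMat, mul_comm]
  have hterm (s : Fin n) : companionS (fun i => charCoeff L i x) i s *
        jacobiMat (charCoeff L) x s k
      = (if s = ⟨0, by omega⟩ then
          -charCoeff L i x * fderiv ℝ (charCoeff L s) x (Pi.single k 1) else 0)
        + if (s : ℕ) = (i : ℕ) + 1 then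
          fderiv ℝ (charCoeff L s) x (Pi.single k 1) else 0 := by
    simp only [companionS, jacobiMat, Matrix.of_apply, Fin.ext_iff]
    split_ifs <;> first | omega | simp
  rw [hleft, Matrix.mul_apply]
  simp only [hterm]
  rw [Finset.sum_add_distrib, Finset.sum_ite_eq' Finset.univ, if_pos (Finset.mem_univ _)]
  have hmain := hN.fderiv_charpoly_coeff_col hL x k (m := n - 1 - (i : ℕ)) (by omega)
  have hsuper : (∑ s : Fin n, if (s : ℕ) = (i : ℕ) + 1 then
        fderiv ℝ (charCoeff L s) x (Pi.single k 1) else 0)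
      = if n - 1 - (i : ℕ) = 0 then 0 else
        fderiv ℝ (fun y => (L y).charpoly.coeff (n - 1 - (i : ℕ) - 1)) x (Pi.single k 1) := by
    split_ifs with h
    · exact Finset.sum_eq_zero fun s _ => if_neg (by have := s.isLt; omega)
    · rw [Finset.sum_eq_single (⟨i + 1, by omega⟩ : Fin n)
        (fun s _ hs => if_neg fun h => hs (Fin.ext h)) (by simp)]
      simp only [if_true]
      rw [show n - 1 - (i : ℕ) - 1 = n - 1 - ((i : ℕ) + 1) by omega]
      rfl
  rw [hsuper]
  refine hmain.trans ?_
  rw [sub_eq_neg_add, ← neg_mul]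
  rfl
end

section
/- Let σ₁(x₁,x₂,x₃) = a x₁ + b x₂ + c x₃ with a,b,c ∈ ℝ not all zero, and let σ₂(x₁,x₂,x₃) = a₁₁x₁² + 2a₁₂x₁x₂ + a₂₂x₂² + 2a₁₃x₁x₃ + 2a₂₃x₂x₃ + a₃₃x₃² with coefficients not all zero. Then there exists an invertible linear coordinate change (x₁,x₂,x₃) → (y₁,y₂,y₃) of ℝ³ such that σ₁(y₁,y₂,y₃) = y₁ and σ₂ takes one of the forms: (1) αy₁² ± y₂² ± y₃², (2) αy₁² ± y₂², (3) y₁y₂, (4) y₁y₂ ± y₃², (5) αy₁², for some α ∈ ℝ. -/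
/-- The quadratic form with coefficients `a11, …, a33` on `ℝ³`. -/
def quadForm3 (a11 a12 a22 a13 a23 a33 : ℝ) (v : Fin 3 → ℝ) : ℝ :=
  a11 * v 0 ^ 2 + 2 * a12 * v 0 * v 1 + a22 * v 1 ^ 2
    + 2 * a13 * v 0 * v 2 + 2 * a23 * v 1 * v 2 + a33 * v 2 ^ 2

/-- The pair `(σ, q)` of functions on `ℝ³` can be brought by a linear coordinate change to the
form where `σ` is the first coordinate and `q` is one of the five normal forms. -/
def HasNormalForm (σ q : (Fin 3 → ℝ) → ℝ) : Prop :=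
  ∃ T : (Fin 3 → ℝ) ≃ₗ[ℝ] (Fin 3 → ℝ),
    (∀ y : Fin 3 → ℝ, σ (T y) = y 0) ∧
    ∃ α : ℝ,
      (∃ ε₂ ε₃ : ℝ, (ε₂ = 1 ∨ ε₂ = -1) ∧ (ε₃ = 1 ∨ ε₃ = -1) ∧
          ∀ y : Fin 3 → ℝ, q (T y) = α * y 0 ^ 2 + ε₂ * y 1 ^ 2 + ε₃ * y 2 ^ 2) ∨
      (∃ ε₂ : ℝ, (ε₂ = 1 ∨ ε₂ = -1) ∧
          ∀ y : Fin 3 → ℝ, q (T y) = α * y 0 ^ 2 + ε₂ * y 1 ^ 2) ∨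
      (∀ y : Fin 3 → ℝ, q (T y) = y 0 * y 1) ∨
      (∃ ε₃ : ℝ, (ε₃ = 1 ∨ ε₃ = -1) ∧
          ∀ y : Fin 3 → ℝ, q (T y) = y 0 * y 1 + ε₃ * y 2 ^ 2) ∨
      (∀ y : Fin 3 → ℝ, q (T y) = α * y 0 ^ 2)

namespace HasNormalForm

/-- A linear coordinate change does not affect the existence of a normal form. -/
theorem of_linearEquiv {σ q σ' q' : (Fin 3 → ℝ) → ℝ} (S : (Fin 3 → ℝ) ≃ₗ[ℝ] (Fin 3 → ℝ))
    (hσ : ∀ y, σ (S y) = σ' y) (hq : ∀ y, q (S y) = q' y) (h : HasNormalForm σ' q') :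
    HasNormalForm σ q := by
  obtain ⟨T, hT, α, h⟩ := h
  refine ⟨T.trans S, fun y => by simp [hσ, hT], α, ?_⟩
  simpa only [LinearEquiv.trans_apply, hq] using h

/-- A coordinate change by an explicit matrix with nonzero determinant. -/
theorem of_matrix {σ q σ' q' : (Fin 3 → ℝ) → ℝ} (M : Matrix (Fin 3) (Fin 3) ℝ)
    (hM : M.det ≠ 0) (hσ : ∀ y, σ (M.mulVec y) = σ' y) (hq : ∀ y, q (M.mulVec y) = q' y)
    (h : HasNormalForm σ' q') : HasNormalForm σ q :=
  of_linearEquiv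
    (Matrix.toLinearEquiv' M (M.invertibleOfIsUnitDet (isUnit_iff_ne_zero.mpr hM))) hσ hq h

/-- Exchanging the last two coordinates. -/
theorem swap {A B C D E F : ℝ}
    (h : HasNormalForm (fun y => y 0) (quadForm3 A D F B E C)) :
    HasNormalForm (fun y => y 0) (quadForm3 A B C D E F) := by
  refine of_matrix !![1, 0, 0; 0, 0, 1; 0, 1, 0] ?_ (fun y => ?_) (fun y => ?_) h
  · simp [Matrix.det_fin_three]
  · simp [Matrix.mulVec, dotProduct, Fin.sum_univ_three]
  · simp [Matrix.mulVec, dotProduct, Fin.sum_univ_three, quadForm3]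
    ring

/-- Completing the square in the second coordinate when its square has a nonzero coefficient. -/
theorem of_complete_square {A B C D F : ℝ} (hC : C ≠ 0)
    (h : ∀ A' ε : ℝ, (ε = 1 ∨ ε = -1) →
      HasNormalForm (fun y => y 0) (quadForm3 A' 0 ε D 0 F)) :
    HasNormalForm (fun y => y 0) (quadForm3 A B C D 0 F) := by
  obtain ⟨ε, r, hε, hr, hCr⟩ :
      ∃ ε r : ℝ, (ε = 1 ∨ ε = -1) ∧ r ≠ 0 ∧ C * r ^ 2 = ε := by
    rcases lt_or_gt_of_ne hC with hC | hC
    · have hs := Real.sqrt_pos.mpr (neg_pos.mpr hC)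
      refine ⟨-1, (√(-C))⁻¹, Or.inr rfl, (inv_pos.mpr hs).ne', ?_⟩
      rw [inv_pow, Real.sq_sqrt (neg_pos.mpr hC).le]
      field_simp
    · have hs := Real.sqrt_pos.mpr hC
      refine ⟨1, (√C)⁻¹, Or.inl rfl, (inv_pos.mpr hs).ne', ?_⟩
      rw [inv_pow, Real.sq_sqrt hC.le]
      field_simp
  refine of_matrix !![1, 0, 0; -B / C, r, 0; 0, 0, 1] ?_ (fun y => ?_) (fun y => ?_)
    (h (A - B ^ 2 / C) ε hε)
  · simpa [Matrix.det_fin_three] using hr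
  · simp [Matrix.mulVec, dotProduct, Fin.sum_univ_three]
  · simp [Matrix.mulVec, dotProduct, Fin.sum_univ_three, quadForm3, ← hCr]
    field_simp
    ring

/-- The case where only the second coordinate enters with a square. -/
theorem of_single_square (A D : ℝ) {ε : ℝ} (hε : ε = 1 ∨ ε = -1) :
    HasNormalForm (fun y => y 0) (quadForm3 A 0 ε D 0 0) := by
  by_cases hD : D = 0
  · subst hD
    exact ⟨LinearEquiv.refl ℝ _, fun y => rfl, A, Or.inr <| Or.inl
      ⟨ε, hε, fun y => by simp [quadForm3]⟩⟩
  · refine of_matrix (σ' := fun y => y 0) (q' := fun y => y 0 * y 1 + ε * y 2 ^ 2)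
      !![1, 0, 0; 0, 0, 1; -A / (2 * D), 1 / (2 * D), 0] ?_ (fun y => ?_) (fun y => ?_)
      ⟨LinearEquiv.refl ℝ _, fun y => rfl, 0, Or.inr <| Or.inr <| Or.inr <| Or.inl
        ⟨ε, hε, fun y => rfl⟩⟩
    · simp [Matrix.det_fin_three, hD]
    · simp [Matrix.mulVec, dotProduct, Fin.sum_univ_three]
    · simp [Matrix.mulVec, dotProduct, Fin.sum_univ_three, quadForm3]
      field_simp
      ring

/-- A form divisible by the first coordinate which involves the second one. -/
theorem of_no_square {A B : ℝ} (D : ℝ) (hB : B ≠ 0) :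
    HasNormalForm (fun y => y 0) (quadForm3 A B 0 D 0 0) := by
  refine of_matrix (σ' := fun y => y 0) (q' := fun y => y 0 * y 1)
    !![1, 0, 0; -A / (2 * B), 1 / (2 * B), -D / B; 0, 0, 1] ?_ (fun y => ?_) (fun y => ?_)
    ⟨LinearEquiv.refl ℝ _, fun y => rfl, 0, Or.inr <| Or.inr <| Or.inl fun y => rfl⟩
  · simp [Matrix.det_fin_three, hB]
  · simp [Matrix.mulVec, dotProduct, Fin.sum_univ_three]
  · simp [Matrix.mulVec, dotProduct, Fin.sum_univ_three, quadForm3]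
    field_simp
    ring

/-- Forms whose restriction to the kernel of the first coordinate is diagonal. -/
theorem of_diagonal (A B C D F : ℝ) :
    HasNormalForm (fun y => y 0) (quadForm3 A B C D 0 F) := by
  by_cases hC : C = 0
  · subst hC
    by_cases hF : F = 0
    · subst hF
      by_cases hB : B = 0
      · subst hB
        by_cases hD : D = 0
        · subst hD
          exact ⟨LinearEquiv.refl ℝ _, fun y => rfl, A, Or.inr <| Or.inr <| Or.inr <| Or.inr
            fun y => by simp [quadForm3]⟩
        · exact swap (of_no_square 0 hD)
      · exact of_no_square D hB
    · exact swap (of_complete_square hF fun A' ε hε => of_single_square A' B hε)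
  · refine of_complete_square hC fun A' ε hε => ?_
    by_cases hF : F = 0
    · subst hF
      exact of_single_square A' D hε
    · exact swap (of_complete_square hF fun A'' ε' hε' => ⟨LinearEquiv.refl ℝ _, fun y => rfl,
        A'', Or.inl ⟨ε', ε, hε', hε, fun y => by simp [quadForm3]⟩⟩)

theorem of_coeff_ne_zero (A B : ℝ) {C : ℝ} (D E F : ℝ) (hC : C ≠ 0) :
    HasNormalForm (fun y => y 0) (quadForm3 A B C D E F) := by
  refine of_matrix !![1, 0, 0; 0, 1, -E / C; 0, 0, 1] ?_ (fun y => ?_) (fun y => ?_)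
    (of_diagonal A B C (D - B * E / C) (F - E ^ 2 / C))
  · simp [Matrix.det_fin_three]
  · simp [Matrix.mulVec, dotProduct, Fin.sum_univ_three]
  · simp [Matrix.mulVec, dotProduct, Fin.sum_univ_three, quadForm3]
    field_simp
    ring

/-- Every quadratic form has a normal form relative to the first coordinate. -/
theorem of_quadForm3 (A B C D E F : ℝ) :
    HasNormalForm (fun y => y 0) (quadForm3 A B C D E F) := by
  by_cases hC : C = 0
  · subst hC
    by_cases hF : F = 0
    · subst hF
      by_cases hE : E = 0
      · subst hE
        exact of_diagonal A B 0 D 0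
      · refine of_matrix !![1, 0, 0; 0, 1, 0; 0, 1, 1] ?_ (fun y => ?_) (fun y => ?_)
          (of_coeff_ne_zero A (B + D) (C := 2 * E) D E 0 (by simpa using hE))
        · simp [Matrix.det_fin_three]
        · simp [Matrix.mulVec, dotProduct, Fin.sum_univ_three]
        · simp [Matrix.mulVec, dotProduct, Fin.sum_univ_three, quadForm3]
          ring
    · exact swap (of_coeff_ne_zero A D B E 0 hF)
  · exact of_coeff_ne_zero A B D E F hC

end HasNormalForm

/-- Pulling back a quadratic form along a matrix gives a quadratic form. -/
theorem exists_quadForm3_mulVec (M : Matrix (Fin 3) (Fin 3) ℝ) (a11 a12 a22 a13 a23 a33 : ℝ) :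
    ∃ A B C D E F : ℝ, ∀ y, quadForm3 a11 a12 a22 a13 a23 a33 (M.mulVec y) =
      quadForm3 A B C D E F y := by
  let b : (Fin 3 → ℝ) → (Fin 3 → ℝ) → ℝ := fun u v =>
    a11 * u 0 * v 0 + a12 * (u 0 * v 1 + u 1 * v 0) + a22 * u 1 * v 1
      + a13 * (u 0 * v 2 + u 2 * v 0) + a23 * (u 1 * v 2 + u 2 * v 1) + a33 * u 2 * v 2
  refine ⟨b (M.col 0) (M.col 0), b (M.col 0) (M.col 1), b (M.col 1) (M.col 1),
    b (M.col 0) (M.col 2), b (M.col 1) (M.col 2), b (M.col 2) (M.col 2), fun y => ?_⟩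
  simp only [b, quadForm3, Matrix.mulVec, dotProduct, Fin.sum_univ_three, Matrix.col_apply]
  ring

/-- A nonzero linear form on `ℝ³` is the first coordinate of a linear coordinate system. -/
theorem exists_matrix_linearForm {a b c : ℝ} (h : ¬(a = 0 ∧ b = 0 ∧ c = 0)) :
    ∃ M : Matrix (Fin 3) (Fin 3) ℝ, M.det ≠ 0 ∧
      ∀ y, a * M.mulVec y 0 + b * M.mulVec y 1 + c * M.mulVec y 2 = y 0 := by
  by_cases ha : a = 0
  · by_cases hb : b = 0
    · have hc : c ≠ 0 := fun hc => h ⟨ha, hb, hc⟩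
      refine ⟨!![0, 1, 0; 0, 0, 1; 1 / c, 0, 0], by simp [Matrix.det_fin_three, hc], fun y => ?_⟩
      simp [Matrix.mulVec, dotProduct, Fin.sum_univ_three, ha, hb]
      field_simp
    · refine ⟨!![0, 1, 0; 1 / b, 0, -c / b; 0, 0, 1], by simp [Matrix.det_fin_three, hb],
        fun y => ?_⟩
      simp [Matrix.mulVec, dotProduct, Fin.sum_univ_three, ha]
      field_simp
      ring
  · refine ⟨!![1 / a, -b / a, -c / a; 0, 1, 0; 0, 0, 1], by simp [Matrix.det_fin_three, ha],
      fun y => ?_⟩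
    simp [Matrix.mulVec, dotProduct, Fin.sum_univ_three]
    field_simp
    ring

/-- Simultaneous reduction of a nonzero linear form `σ₁` and a nonzero quadratic
form `σ₂` on `ℝ³` by a linear coordinate change: `σ₁` becomes `y₁` and `σ₂` one of
`αy₁² ± y₂² ± y₃²`, `αy₁² ± y₂²`, `y₁y₂`, `y₁y₂ ± y₃²`, `αy₁²`. -/
theorem stmt5 (a b c a11 a12 a22 a13 a23 a33 : ℝ)
    (h1 : ¬(a = 0 ∧ b = 0 ∧ c = 0))
    (h2 : ¬(a11 = 0 ∧ a12 = 0 ∧ a22 = 0 ∧ a13 = 0 ∧ a23 = 0 ∧ a33 = 0)) :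
    ∃ T : (Fin 3 → ℝ) ≃ₗ[ℝ] (Fin 3 → ℝ),
      (∀ y : Fin 3 → ℝ, a * T y 0 + b * T y 1 + c * T y 2 = y 0) ∧
      ∃ α : ℝ,
        (∃ ε₂ ε₃ : ℝ, (ε₂ = 1 ∨ ε₂ = -1) ∧ (ε₃ = 1 ∨ ε₃ = -1) ∧
            ∀ y : Fin 3 → ℝ, quadForm3 a11 a12 a22 a13 a23 a33 (T y)
              = α * y 0 ^ 2 + ε₂ * y 1 ^ 2 + ε₃ * y 2 ^ 2) ∨
        (∃ ε₂ : ℝ, (ε₂ = 1 ∨ ε₂ = -1) ∧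
            ∀ y : Fin 3 → ℝ, quadForm3 a11 a12 a22 a13 a23 a33 (T y)
              = α * y 0 ^ 2 + ε₂ * y 1 ^ 2) ∨
        (∀ y : Fin 3 → ℝ, quadForm3 a11 a12 a22 a13 a23 a33 (T y) = y 0 * y 1) ∨
        (∃ ε₃ : ℝ, (ε₃ = 1 ∨ ε₃ = -1) ∧
            ∀ y : Fin 3 → ℝ, quadForm3 a11 a12 a22 a13 a23 a33 (T y)
              = y 0 * y 1 + ε₃ * y 2 ^ 2) ∨
        (∀ y : Fin 3 → ℝ, quadForm3 a11 a12 a22 a13 a23 a33 (T y) = α * y 0 ^ 2) := by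
  obtain ⟨M, hM, hσ⟩ := exists_matrix_linearForm h1
  obtain ⟨A, B, C, D, E, F, hq⟩ := exists_quadForm3_mulVec M a11 a12 a22 a13 a23 a33
  exact HasNormalForm.of_matrix (σ := fun v => a * v 0 + b * v 1 + c * v 2) M hM hσ hq
    (HasNormalForm.of_quadForm3 A B C D E F)
end

section
/- Every 3-dimensional differentially non-degenerate left-symmetric algebra over ℝ is isomorphic (as an algebra) to one of the eight algebras whose right-adjoint operators, in coordinates (x,y,z) on ℝ³, are the linear Nijenhuis operators: (1) [[2x,−y,0],[y,0,0],[0,0,z]]; (2) [[2x,y,0],[y,0,0],[0,0,z]]; (3) [[x,y,0],[y,x,0],[0,0,z]]; (4) [[x,−y,0],[y,x,0],[0,0,z]]; (5) [[2x−z,−y,z−x],[y,z,0],[0,0,z]]; (6) [[2x−z,y,z−x],[y,z,0],[0,0,z]]; (7) [[x,−z,−y],[y,0,−y],[0,0,z]]; (8) [[−x,z,y],[−(2/3)y,0,z],[−(1/3)z,0,0]]. Conversely, each of these eight operator fields is the right-adjoint operator of a differentially non-degenerate LSA. -/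
open Matrix

/-- The eight model 3-dimensional linear Nijenhuis operator fields. -/
noncomputable def models3 : Fin 8 → ((Fin 3 → ℝ) → Matrix (Fin 3) (Fin 3) ℝ) :=
  ![fun x => Matrix.of ![![2 * x 0, -x 1, 0], ![x 1, 0, 0], ![0, 0, x 2]],
    fun x => Matrix.of ![![2 * x 0, x 1, 0], ![x 1, 0, 0], ![0, 0, x 2]],
    fun x => Matrix.of ![![x 0, x 1, 0], ![x 1, x 0, 0], ![0, 0, x 2]],
    fun x => Matrix.of ![![x 0, -x 1, 0], ![x 1, x 0, 0], ![0, 0, x 2]],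
    fun x => Matrix.of ![![2 * x 0 - x 2, -x 1, x 2 - x 0], ![x 1, x 2, 0], ![0, 0, x 2]],
    fun x => Matrix.of ![![2 * x 0 - x 2, x 1, x 2 - x 0], ![x 1, x 2, 0], ![0, 0, x 2]],
    fun x => Matrix.of ![![x 0, -x 2, -x 1], ![x 1, 0, -x 1], ![0, 0, x 2]],
    fun x => Matrix.of ![![-x 0, x 2, x 1],
                         ![-(2 / 3) * x 1, 0, x 2], ![-(1 / 3) * x 2, 0, 0]]]

/-- Structure constants of the algebra whose right-adjoint operator is the linear
operator field `L`. -/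
def scOfOp {n : ℕ} (L : (Fin n → ℝ) → Matrix (Fin n) (Fin n) ℝ)
    (i j k : Fin n) : ℝ :=
  L (Pi.single j 1) k i

theorem forall_fin_three {P : Fin 3 → Prop} (h0 : P 0) (h1 : P 1) (h2 : P 2) : ∀ i, P i := by
  intro i; fin_cases i <;> assumption

theorem mulSC_eq_mulVec {n : ℕ} (a : Fin n → Fin n → Fin n → ℝ) (ξ η : Fin n → ℝ) :
    mulSC a ξ η = rightAdj a η *ᵥ ξ := by
  funext k
  simp only [mulSC, rightAdj, mulVec, dotProduct, Matrix.of_apply, Finset.sum_mul]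
  exact Finset.sum_congr rfl fun _ _ => Finset.sum_congr rfl fun _ _ => by ring

theorem mulSC_single_left {n : ℕ} (a : Fin n → Fin n → Fin n → ℝ) (j : Fin n) (x : Fin n → ℝ)
    (k : Fin n) : mulSC a (Pi.single j 1) x k = ∑ p, a j p k * x p := by
  simp [mulSC, Pi.single_apply]

theorem mulSC_single_single {n : ℕ} (a : Fin n → Fin n → Fin n → ℝ) (i j k : Fin n) :
    mulSC a (Pi.single i 1) (Pi.single j 1) k = a i j k := by
  simp [mulSC, Pi.single_apply]

theorem fderiv_rightAdj_single {n : ℕ} (a : Fin n → Fin n → Fin n → ℝ) (x : Fin n → ℝ)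
    (i k s : Fin n) :
    fderiv ℝ (fun y => rightAdj a y i k) x (Pi.single s 1) = a k s i := by
  let f : (Fin n → ℝ) →L[ℝ] ℝ :=
    ∑ j : Fin n, a k j i • ContinuousLinearMap.proj (R := ℝ) (φ := fun _ : Fin n => ℝ) j
  have h : (fun y => rightAdj a y i k) = f := by
    funext y
    simp [f, rightAdj]
  rw [h, ContinuousLinearMap.fderiv]
  simp [f, Pi.single_apply]

theorem IsLSA.isNijenhuis_rightAdj {n : ℕ} {a : Fin n → Fin n → Fin n → ℝ} (h : IsLSA a) :
    IsNijenhuis (rightAdj a) := by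
  intro x i j k
  have h1 := congrFun (h (Pi.single j 1) (Pi.single k 1) x) i
  have hl : ∀ u : Fin n → ℝ, mulSC a u x i = ∑ s, rightAdj a x i s * u s := by
    intro u
    rw [mulSC_eq_mulVec]; rfl
  have hr : ∀ (j : Fin n) (u : Fin n → ℝ),
      mulSC a (Pi.single j 1) (mulSC a u x) i = ∑ s, mulSC a u x s * a j s i := by
    intro j u
    rw [mulSC_single_left]
    exact Finset.sum_congr rfl fun _ _ => mul_comm _ _
  have hs : ∀ (j s : Fin n), mulSC a (Pi.single j 1) x s = rightAdj a x s j := by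
    intro j s
    rw [mulSC_single_left]; rfl
  simp only [Pi.sub_apply, hr, hs] at h1
  simp only [hl, mulSC_single_single] at h1
  simp only [nijTorsion, fderiv_rightAdj_single, Finset.sum_add_distrib, Finset.sum_sub_distrib]
  linarith

/-- A family of smooth functions with a submersion point is algebraically independent. -/
theorem algebraicIndependent_of_hasStrictFDerivAt {n : ℕ} (f : Fin n → (Fin n → ℝ) → ℝ)
    (x : Fin n → ℝ) (f' : (Fin n → ℝ) →L[ℝ] (Fin n → ℝ))
    (hf : HasStrictFDerivAt (fun y i => f i y) f' x) (hf' : f'.range = ⊤) :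
    AlgebraicIndependent ℝ f := by
  rw [algebraicIndependent_iff]
  intro P hP
  have hmem : Set.range (fun y i => f i y) ∈ nhds (fun i => f i x) := by
    rw [← hf.map_nhds_eq_of_surj hf']
    exact Filter.mem_map.2 (Filter.Eventually.of_forall fun y => Set.mem_range_self y)
  rw [nhds_pi, Filter.mem_pi'] at hmem
  obtain ⟨I, t, ht, hsub⟩ := hmem
  refine MvPolynomial.funext_set t (fun i => infinite_of_mem_nhds _ (ht i)) fun v hv => ?_
  obtain ⟨y, hy⟩ := hsub fun i _ => hv i trivial
  have h1 := congrFun hP y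
  have h2 := MvPolynomial.comp_aeval_apply f (Pi.evalAlgHom ℝ (fun _ : Fin n → ℝ => ℝ) y) P
  simp only [Pi.evalAlgHom_apply, h1, Pi.zero_apply] at h2
  rw [← hy, map_zero, h2]
  rfl

theorem charpoly_fin_three (M : Matrix (Fin 3) (Fin 3) ℝ) :
    M.charpoly = Polynomial.X ^ 3 - Polynomial.C M.trace * Polynomial.X ^ 2
      + Polynomial.C ((M.trace ^ 2 - (M * M).trace) / 2) * Polynomial.X
      - Polynomial.C M.det := by
  have h2 : (M.trace ^ 2 - (M * M).trace) / 2 = M 0 0 * M 1 1 - M 0 1 * M 1 0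
      + (M 0 0 * M 2 2 - M 0 2 * M 2 0) + (M 1 1 * M 2 2 - M 1 2 * M 2 1) := by
    simp only [Matrix.trace_fin_three, Matrix.mul_apply, Fin.sum_univ_three]; ring
  rw [h2]
  simp [Matrix.charpoly, Matrix.det_fin_three, Matrix.trace_fin_three]
  ring

theorem charCoeff_three (L : (Fin 3 → ℝ) → Matrix (Fin 3) (Fin 3) ℝ) (x : Fin 3 → ℝ) :
    charCoeff L 0 x = -(L x).trace ∧
    charCoeff L 1 x = ((L x).trace ^ 2 - (L x * L x).trace) / 2 ∧
    charCoeff L 2 x = -(L x).det := by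
  refine ⟨?_, ?_, ?_⟩ <;>
    simp [charCoeff, charpoly_fin_three, Polynomial.coeff_X, Polynomial.coeff_C,
      Polynomial.coeff_X_pow]

theorem rightAdj_add_smul_single {n : ℕ} (a : Fin n → Fin n → Fin n → ℝ) (x : Fin n → ℝ)
    (j : Fin n) (t : ℝ) :
    rightAdj a (x + t • Pi.single j 1) = rightAdj a x + t • rightAdj a (Pi.single j 1) := by
  ext i k
  simp [rightAdj, mul_add, Finset.sum_add_distrib, Pi.single_apply, mul_comm]

/-- The Jacobi matrix, at a point where the operator is `R`, of the characteristic coefficients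
of a linear operator field with values `S j` on the standard basis. -/
def charJacobi (R : Matrix (Fin 3) (Fin 3) ℝ) (S : Fin 3 → Matrix (Fin 3) (Fin 3) ℝ) :
    Matrix (Fin 3) (Fin 3) ℝ :=
  Matrix.of ![fun j => -(S j).trace,
    fun j => R.trace * (S j).trace - (R * S j).trace,
    fun j => -(R.adjugate * S j).trace]

theorem hasDerivAt_of_eq_cubic {g : ℝ → ℝ} {c₀ c₁ c₂ c₃ : ℝ}
    (h : ∀ t, g t = c₀ + c₁ * t + c₂ * t ^ 2 + c₃ * t ^ 3) : HasDerivAt g c₁ 0 := by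
  rw [funext h]
  have h1 := (((hasDerivAt_id (0 : ℝ)).const_mul c₁).const_add c₀).add
    (((hasDerivAt_id (0 : ℝ)).pow 2).const_mul c₂)
  have h2 := h1.add (((hasDerivAt_id (0 : ℝ)).pow 3).const_mul c₃)
  refine (h2.congr_deriv ?_).congr_of_eventuallyEq (Filter.Eventually.of_forall fun t => ?_)
  · simp
  · simp

theorem hasDerivAt_charCoeff (a : Fin 3 → Fin 3 → Fin 3 → ℝ) (x : Fin 3 → ℝ) (i j : Fin 3) :
    HasDerivAt (fun t : ℝ => charCoeff (rightAdj a) i (x + t • Pi.single j 1))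
      (charJacobi (rightAdj a x) (fun j => rightAdj a (Pi.single j 1)) i j) 0 := by
  generalize hR : rightAdj a x = R
  generalize hS : rightAdj a (Pi.single j 1) = S
  revert i
  refine forall_fin_three ?_ ?_ ?_
  · refine hasDerivAt_of_eq_cubic (c₀ := -R.trace) (c₂ := 0) (c₃ := 0) fun t => ?_
    rw [(charCoeff_three _ _).1, rightAdj_add_smul_single, hR, hS]
    simp [charJacobi, hS]
    ring
  · refine hasDerivAt_of_eq_cubic (c₀ := (R.trace ^ 2 - (R * R).trace) / 2)
      (c₂ := (S.trace ^ 2 - (S * S).trace) / 2) (c₃ := 0) fun t => ?_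
    rw [(charCoeff_three _ _).2.1, rightAdj_add_smul_single, hR, hS]
    simp [charJacobi, hS, Matrix.add_mul, Matrix.mul_add, Matrix.trace_mul_comm S R]
    ring
  · refine hasDerivAt_of_eq_cubic (c₀ := -R.det)
      (c₂ := -(R * S.adjugate).trace) (c₃ := -S.det) fun t => ?_
    rw [(charCoeff_three _ _).2.2, rightAdj_add_smul_single, hR, hS]
    simp only [charJacobi, hS, Matrix.of_apply, Matrix.cons_val, Matrix.det_fin_three,
      Matrix.adjugate_fin_three, Matrix.trace_fin_three, Matrix.mul_apply, Fin.sum_univ_three,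
      Matrix.add_apply, Matrix.smul_apply, smul_eq_mul]
    simp
    ring

theorem contDiff_charCoeff (a : Fin 3 → Fin 3 → Fin 3 → ℝ) :
    ContDiff ℝ 1 (fun y i => charCoeff (rightAdj a) i y) := by
  have he : ∀ i k, ContDiff ℝ 1 fun y => rightAdj a y i k := by
    intro i k
    simp only [rightAdj, Matrix.of_apply]
    fun_prop
  rw [contDiff_pi]
  refine forall_fin_three ?_ ?_ ?_
  · simp only [(charCoeff_three _ _).1, Matrix.trace_fin_three]
    fun_prop
  · simp only [(charCoeff_three _ _).2.1, Matrix.trace_fin_three, Matrix.mul_apply,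
      Fin.sum_univ_three]
    fun_prop
  · simp only [(charCoeff_three _ _).2.2, Matrix.det_fin_three]
    fun_prop

theorem diffNonDeg_of_det_charJacobi_ne_zero (a : Fin 3 → Fin 3 → Fin 3 → ℝ) (x : Fin 3 → ℝ)
    (h : (charJacobi (rightAdj a x) fun j => rightAdj a (Pi.single j 1)).det ≠ 0) :
    DiffNonDeg a := by
  set J := charJacobi (rightAdj a x) fun j => rightAdj a (Pi.single j 1) with hJ
  set F : (Fin 3 → ℝ) → (Fin 3 → ℝ) := fun y i => charCoeff (rightAdj a) i y with hF
  have hs : HasStrictFDerivAt F (fderiv ℝ F x) x :=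
    (contDiff_charCoeff a).contDiffAt.hasStrictFDerivAt one_ne_zero
  have hcol : ∀ j, fderiv ℝ F x (Pi.single j 1) = fun i => J i j := by
    intro j
    have hline : HasDerivAt (fun t : ℝ => x + t • (Pi.single j 1 : Fin 3 → ℝ))
        (Pi.single j 1) 0 := by
      simpa using ((hasDerivAt_id (0 : ℝ)).smul_const (Pi.single j 1 : Fin 3 → ℝ)).const_add x
    have h1 : HasDerivAt (fun t : ℝ => F (x + t • Pi.single j 1))
        (fderiv ℝ F x (Pi.single j 1)) 0 :=
      HasFDerivAt.comp_hasDerivAt (l := F) (l' := fderiv ℝ F x) (0 : ℝ)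
        (by rw [zero_smul, add_zero]; exact hs.hasFDerivAt) hline
    exact h1.unique (hasDerivAt_pi.2 fun i => hasDerivAt_charCoeff a x i j)
  have hmul : ∀ v, fderiv ℝ F x v = J *ᵥ v := by
    intro v
    have hv : v = ∑ j, v j • (Pi.single j 1 : Fin 3 → ℝ) := by
      funext i
      simp [Finset.sum_apply, Pi.single_apply]
    conv_lhs => rw [hv]
    simp only [map_sum, map_smul, hcol]
    funext i
    simp [mulVec, dotProduct, mul_comm]
  refine algebraicIndependent_of_hasStrictFDerivAt _ x _ hs ?_
  refine LinearMap.range_eq_top.2 fun w => ⟨J⁻¹ *ᵥ w, ?_⟩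
  change fderiv ℝ F x _ = w
  rw [hmul, Matrix.mulVec_mulVec, Matrix.mul_nonsing_inv _ (Ne.isUnit h), Matrix.one_mulVec]

theorem models3_zero : models3 0 = fun x =>
    !![2 * x 0, -x 1, 0; x 1, 0, 0; 0, 0, x 2] := rfl

theorem models3_one : models3 1 = fun x =>
    !![2 * x 0, x 1, 0; x 1, 0, 0; 0, 0, x 2] := rfl

theorem models3_two : models3 2 = fun x =>
    !![x 0, x 1, 0; x 1, x 0, 0; 0, 0, x 2] := rfl

theorem models3_three : models3 3 = fun x =>
    !![x 0, -x 1, 0; x 1, x 0, 0; 0, 0, x 2] := rfl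

theorem models3_four : models3 4 = fun x =>
    !![2 * x 0 - x 2, -x 1, x 2 - x 0; x 1, x 2, 0; 0, 0, x 2] := rfl

theorem models3_five : models3 5 = fun x =>
    !![2 * x 0 - x 2, x 1, x 2 - x 0; x 1, x 2, 0; 0, 0, x 2] := rfl

theorem models3_six : models3 6 = fun x =>
    !![x 0, -x 2, -x 1; x 1, 0, -x 1; 0, 0, x 2] := rfl

theorem models3_seven : models3 7 = fun x =>
    !![-x 0, x 2, x 1; -(2 / 3) * x 1, 0, x 2; -(1 / 3) * x 2, 0, 0] := rfl

theorem forall_fin_eight {P : Fin 8 → Prop} (h0 : P 0) (h1 : P 1) (h2 : P 2) (h3 : P 3)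
    (h4 : P 4) (h5 : P 5) (h6 : P 6) (h7 : P 7) : ∀ i, P i := by
  intro i; fin_cases i <;> assumption

theorem rightAdj_scOfOp_models3 (m : Fin 8) :
    rightAdj (scOfOp (models3 m)) = models3 m := by
  funext x
  ext k i
  simp only [rightAdj, scOfOp, Matrix.of_apply, Fin.sum_univ_three]
  revert m
  refine forall_fin_eight ?_ ?_ ?_ ?_ ?_ ?_ ?_ ?_ <;>
    simp only [models3_zero, models3_one, models3_two, models3_three, models3_four, models3_five,
      models3_six, models3_seven] <;> revert k i <;>
    refine forall_fin_three (forall_fin_three ?_ ?_ ?_) (forall_fin_three ?_ ?_ ?_)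
      (forall_fin_three ?_ ?_ ?_) <;>
    simp <;> ring

theorem isLSA_scOfOp_models3 (m : Fin 8) : IsLSA (scOfOp (models3 m)) := by
  intro ξ η ζ
  simp only [mulSC_eq_mulVec, rightAdj_scOfOp_models3]
  funext k
  revert m
  refine forall_fin_eight ?_ ?_ ?_ ?_ ?_ ?_ ?_ ?_ <;>
    simp only [models3_zero, models3_one, models3_two, models3_three, models3_four, models3_five,
      models3_six, models3_seven] <;> revert k <;>
    refine forall_fin_three ?_ ?_ ?_ <;>
    simp only [mulVec, dotProduct, Fin.sum_univ_three, Pi.sub_apply, Matrix.of_apply,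
      Matrix.cons_val] <;> ring

theorem diffNonDeg_scOfOp_models3 (m : Fin 8) : DiffNonDeg (scOfOp (models3 m)) := by
  refine diffNonDeg_of_det_charJacobi_ne_zero _ ![0, 1, 2] ?_
  rw [rightAdj_scOfOp_models3]
  revert m
  refine forall_fin_eight ?_ ?_ ?_ ?_ ?_ ?_ ?_ ?_ <;>
    simp only [models3_zero, models3_one, models3_two, models3_three, models3_four, models3_five,
      models3_six, models3_seven] <;>
    simp [charJacobi, Matrix.det_fin_three, Matrix.trace_fin_three, Matrix.adjugate_fin_three] <;>
    norm_num

/-- The matrix of left multiplication by `η`. -/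
def leftMul {n : ℕ} (a : Fin n → Fin n → Fin n → ℝ) (η : Fin n → ℝ) :
    Matrix (Fin n) (Fin n) ℝ :=
  Matrix.of fun k j => ∑ i, a i j k * η i

theorem mulSC_eq_leftMul {n : ℕ} (a : Fin n → Fin n → Fin n → ℝ) (ξ η : Fin n → ℝ) :
    mulSC a ξ η = leftMul a ξ *ᵥ η := by
  funext k
  simp only [mulSC, leftMul, mulVec, dotProduct, Matrix.of_apply, Finset.sum_mul]
  exact Finset.sum_comm

theorem IsLSA.rightAdj_mulSC {n : ℕ} {a : Fin n → Fin n → Fin n → ℝ} (h : IsLSA a)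
    (η ζ : Fin n → ℝ) :
    rightAdj a (mulSC a η ζ) =
      rightAdj a ζ * rightAdj a η - rightAdj a ζ * leftMul a η + leftMul a η * rightAdj a ζ := by
  refine Matrix.toLin'.injective (LinearMap.ext fun ξ => ?_)
  simp only [Matrix.toLin'_apply, Matrix.add_mulVec, Matrix.sub_mulVec, ← Matrix.mulVec_mulVec,
    ← mulSC_eq_mulVec, ← mulSC_eq_leftMul]
  rw [← sub_eq_zero, ← sub_eq_zero.2 (h η ξ ζ)]
  abel

theorem IsLSA.trace_rightAdj_mulSC {n : ℕ} {a : Fin n → Fin n → Fin n → ℝ} (h : IsLSA a)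
    (η ζ : Fin n → ℝ) :
    (rightAdj a (mulSC a η ζ)).trace = (rightAdj a ζ * rightAdj a η).trace := by
  rw [h.rightAdj_mulSC, Matrix.trace_add, Matrix.trace_sub, Matrix.trace_mul_comm (leftMul a η)]
  ring

theorem IsLSA.trace_rightAdj_cube {n : ℕ} {a : Fin n → Fin n → Fin n → ℝ} (h : IsLSA a)
    (x : Fin n → ℝ) :
    (rightAdj a (mulSC a (mulSC a x x) x)).trace =
      (rightAdj a x * rightAdj a x * rightAdj a x).trace := by
  rw [h.trace_rightAdj_mulSC, h.rightAdj_mulSC, Matrix.mul_add, Matrix.mul_sub, Matrix.trace_add,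
    Matrix.trace_sub, ← Matrix.mul_assoc (rightAdj a x) (leftMul a x),
    Matrix.trace_mul_comm (rightAdj a x * leftMul a x), Matrix.mul_assoc]
  ring

theorem trace_cube_fin_three (M : Matrix (Fin 3) (Fin 3) ℝ) :
    (M * M * M).trace = M.trace ^ 3 - 3 * M.trace * ((M.trace ^ 2 - (M * M).trace) / 2)
      + 3 * M.det := by
  simp only [Matrix.trace_fin_three, Matrix.det_fin_three, Matrix.mul_apply, Fin.sum_univ_three]
  ring

/-- The power sums of the eigenvalues of the right-adjoint operator of a differentially
non-degenerate algebra satisfy no polynomial relation. -/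
theorem DiffNonDeg.eq_zero_of_eval_trace {a : Fin 3 → Fin 3 → Fin 3 → ℝ} (h : DiffNonDeg a)
    (P : MvPolynomial (Fin 3) ℝ)
    (hP : ∀ x, MvPolynomial.eval ![(rightAdj a x).trace, (rightAdj a x * rightAdj a x).trace,
      (rightAdj a x * rightAdj a x * rightAdj a x).trace] P = 0) : P = 0 := by
  let T : Fin 3 → MvPolynomial (Fin 3) ℝ :=
    ![-.X 0, .X 0 ^ 2 - 2 * .X 1, -.X 0 ^ 3 + 3 * .X 0 * .X 1 - 3 * .X 2]
  have hT : ∀ u : Fin 3 → ℝ, MvPolynomial.eval u (MvPolynomial.bind₁ T P) =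
      MvPolynomial.eval ![-u 0, u 0 ^ 2 - 2 * u 1, -u 0 ^ 3 + 3 * u 0 * u 1 - 3 * u 2] P := by
    intro u
    have hu : (fun i => MvPolynomial.eval u (T i)) =
        ![-u 0, u 0 ^ 2 - 2 * u 1, -u 0 ^ 3 + 3 * u 0 * u 1 - 3 * u 2] := by
      funext i
      revert i
      refine forall_fin_three ?_ ?_ ?_ <;> simp [T]
    rw [← hu]
    exact MvPolynomial.eval₂Hom_bind₁ (RingHom.id ℝ) u T P
  have h0 : MvPolynomial.bind₁ T P = 0 := by
    refine h.eq_zero_of_aeval_eq_zero _ (funext fun x => ?_)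
    have h2 := MvPolynomial.comp_aeval_apply (charCoeff (rightAdj a))
      (Pi.evalAlgHom ℝ (fun _ : Fin 3 → ℝ => ℝ) x) (MvPolynomial.bind₁ T P)
    rw [Pi.evalAlgHom_apply] at h2
    rw [h2]
    refine (hT _).trans ?_
    obtain ⟨e0, e1, e2⟩ := charCoeff_three (rightAdj a) x
    refine Eq.trans ?_ (hP x)
    simp only [Pi.evalAlgHom_apply, e0, e1, e2]
    rw [trace_cube_fin_three]
    congr 2
    refine Matrix.vec3_eq ?_ ?_ ?_ <;> ring
  refine MvPolynomial.funext fun v => ?_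
  have h1 := hT ![-v 0, (v 0 ^ 2 - v 1) / 2,
    (v 0 ^ 3 - 3 * v 0 * ((v 0 ^ 2 - v 1) / 2) - v 2) / 3]
  rw [h0, map_zero] at h1
  rw [map_zero, h1]
  congr 2
  funext i
  revert i
  refine forall_fin_three ?_ ?_ ?_ <;> simp <;> ring

/-- Membership of the isomorphism class of `a` in the list of models. -/
def IsModel3 (a : Fin 3 → Fin 3 → Fin 3 → ℝ) : Prop :=
  ∃ m : Fin 8, AlgIsoSC a (scOfOp (models3 m))

/-- The structure constants in the basis formed by the columns of an invertible matrix `Q`. -/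
theorem exists_changeBasis {a : Fin 3 → Fin 3 → Fin 3 → ℝ} (hL : IsLSA a) (hN : DiffNonDeg a)
    (Q : Matrix (Fin 3) (Fin 3) ℝ) (hQ : Q.det ≠ 0) :
    ∃ b : Fin 3 → Fin 3 → Fin 3 → ℝ, IsLSA b ∧ DiffNonDeg b ∧ (IsModel3 b → IsModel3 a) ∧
      (∀ x, (rightAdj b x).trace = (rightAdj a (Q *ᵥ x)).trace) ∧
      ∀ x y, Q *ᵥ mulSC b x y = mulSC a (Q *ᵥ x) (Q *ᵥ y) := by
  have hu : IsUnit Q.det := Ne.isUnit hQ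
  let b : Fin 3 → Fin 3 → Fin 3 → ℝ := fun i j k =>
    (Q⁻¹ *ᵥ mulSC a (Q *ᵥ Pi.single i 1) (Q *ᵥ Pi.single j 1)) k
  have hR : ∀ x, rightAdj b x = Q⁻¹ * rightAdj a (Q *ᵥ x) * Q := by
    intro x
    have h1 : ∀ i, rightAdj b x *ᵥ Pi.single i 1 =
        (Q⁻¹ * rightAdj a (Q *ᵥ x) * Q) *ᵥ Pi.single i 1 := by
      intro i
      rw [Matrix.mul_assoc, ← Matrix.mulVec_mulVec, ← Matrix.mulVec_mulVec, ← mulSC_eq_mulVec,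
        ← mulSC_eq_mulVec, mulSC_eq_leftMul a, Matrix.mulVec_mulVec, Matrix.mulVec_mulVec]
      funext k
      rw [mulSC_single_left]
      simp only [mulVec, dotProduct, b]
      refine Finset.sum_congr rfl fun j _ => ?_
      simp only [mulSC_eq_leftMul a, Matrix.mulVec_single_one]
      rw [Matrix.mul_assoc]
      rfl
    ext k i
    simpa using congrFun (h1 i) k
  have hQQ : ∀ M : Matrix (Fin 3) (Fin 3) ℝ, Q * (Q⁻¹ * M) = M := by
    intro M
    rw [← Matrix.mul_assoc, Matrix.mul_nonsing_inv _ hu, Matrix.one_mul]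
  have hmul : ∀ x y, Q *ᵥ mulSC b x y = mulSC a (Q *ᵥ x) (Q *ᵥ y) := by
    intro x y
    rw [mulSC_eq_mulVec, mulSC_eq_mulVec, hR, Matrix.mulVec_mulVec, Matrix.mulVec_mulVec,
      Matrix.mul_assoc, hQQ]
  have hinj : Function.Injective fun v : Fin 3 → ℝ => Q *ᵥ v :=
    Matrix.mulVec_injective_of_isUnit ((Matrix.isUnit_iff_isUnit_det Q).2 hu)
  let e : (Fin 3 → ℝ) ≃ₗ[ℝ] (Fin 3 → ℝ) := Matrix.toLinearEquiv' Q
    (Matrix.invertibleOfIsUnitDet Q hu)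
  have he : ∀ v, e v = Q *ᵥ v := fun v => rfl
  refine ⟨b, ?_, ?_, ?_, ?_, hmul⟩
  · intro ξ η ζ
    apply hinj
    simp only [Matrix.mulVec_sub, hmul]
    exact hL _ _ _
  · have hσ : ∀ i x, charCoeff (rightAdj b) i x = charCoeff (rightAdj a) i (Q *ᵥ x) := by
      intro i x
      have hc : (rightAdj b x).charpoly = (rightAdj a (Q *ᵥ x)).charpoly := by
        rw [hR, Matrix.charpoly_mul_comm, hQQ]
      simp only [charCoeff, hc]
    rw [DiffNonDeg, algebraicIndependent_iff] at hN ⊢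
    intro P hP
    refine hN P (funext fun x => ?_)
    obtain ⟨y, rfl⟩ : ∃ y, Q *ᵥ y = x := ⟨e.symm x, by rw [← he, e.apply_symm_apply]⟩
    have h2 := MvPolynomial.comp_aeval_apply (charCoeff (rightAdj b))
      (Pi.evalAlgHom ℝ (fun _ : Fin 3 → ℝ => ℝ) y) P
    rw [hP] at h2
    have h3 := MvPolynomial.comp_aeval_apply (charCoeff (rightAdj a))
      (Pi.evalAlgHom ℝ (fun _ : Fin 3 → ℝ => ℝ) (Q *ᵥ y)) P
    simp only [Pi.evalAlgHom_apply, hσ] at h2 h3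
    rw [h3, ← h2]
    rfl
  · rintro ⟨m, φ, hφ⟩
    refine ⟨m, e.symm.trans φ, fun ξ η => ?_⟩
    have h1 : e.symm (mulSC a ξ η) = mulSC b (e.symm ξ) (e.symm η) := by
      rw [LinearEquiv.symm_apply_eq, he, hmul, ← he, ← he, e.apply_symm_apply, e.apply_symm_apply]
    simp only [LinearEquiv.trans_apply, h1, hφ]
  · intro x
    rw [hR, Matrix.trace_mul_comm, hQQ]

/-- A differentially non-degenerate LSA for which the trace of the right-adjoint operator is the
first coordinate. -/
structure IsTraceNormal (a : Fin 3 → Fin 3 → Fin 3 → ℝ) : Prop where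
  isLSA : IsLSA a
  diffNonDeg : DiffNonDeg a
  trace_eq : ∀ x, (rightAdj a x).trace = x 0

theorem IsLSA.structureConstants {a : Fin 3 → Fin 3 → Fin 3 → ℝ} (h : IsLSA a)
    (i j l k : Fin 3) :
    (a i j 0 * a 0 l k + a i j 1 * a 1 l k + a i j 2 * a 2 l k)
      - (a j l 0 * a i 0 k + a j l 1 * a i 1 k + a j l 2 * a i 2 k)
      = (a j i 0 * a 0 l k + a j i 1 * a 1 l k + a j i 2 * a 2 l k)
      - (a i l 0 * a j 0 k + a i l 1 * a j 1 k + a i l 2 * a j 2 k) := by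
  have h1 := congrFun (h (Pi.single i 1) (Pi.single j 1) (Pi.single l 1)) k
  have h2 : ∀ ξ : Fin 3 → ℝ, mulSC a ξ (Pi.single l 1) k = ∑ p, a p l k * ξ p := by
    intro ξ
    rw [mulSC_eq_mulVec]
    simp [mulVec, dotProduct, rightAdj, Pi.single_apply]
  simp only [Pi.sub_apply, h2, mulSC_single_single] at h1
  rw [mulSC_single_left, mulSC_single_left] at h1
  simp only [mulSC_single_single, Fin.sum_univ_three] at h1
  linarith

namespace IsTraceNormal

variable {a : Fin 3 → Fin 3 → Fin 3 → ℝ}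

theorem sum_eq (h : IsTraceNormal a) (j : Fin 3) :
    a 0 j 0 + a 1 j 1 + a 2 j 2 = if j = 0 then 1 else 0 := by
  have h1 := h.trace_eq (Pi.single j 1)
  simp only [Matrix.trace_fin_three, rightAdj, Matrix.of_apply, Pi.single_apply, mul_ite, mul_one,
    mul_zero, Finset.sum_ite_eq', Finset.mem_univ, if_true] at h1
  simpa [eq_comm] using h1

theorem trace_sq (h : IsTraceNormal a) (x : Fin 3 → ℝ) :
    (rightAdj a x * rightAdj a x).trace = mulSC a x x 0 := by
  rw [← h.isLSA.trace_rightAdj_mulSC, h.trace_eq]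

theorem trace_cube (h : IsTraceNormal a) (x : Fin 3 → ℝ) :
    (rightAdj a x * rightAdj a x * rightAdj a x).trace = mulSC a (mulSC a x x) x 0 := by
  rw [← h.isLSA.trace_rightAdj_cube, h.trace_eq]

theorem form_eq (h : IsTraceNormal a) (i j : Fin 3) :
    a i j 0 = ∑ k, ∑ l, a l i k * a k j l := by
  have h1 := h.isLSA.trace_rightAdj_mulSC (Pi.single i 1) (Pi.single j 1)
  rw [h.trace_eq, mulSC_single_single, Matrix.trace_mul_comm] at h1
  rw [h1]
  simp [Matrix.trace, Matrix.diag, Matrix.mul_apply, rightAdj, Pi.single_apply]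

theorem form_comm (h : IsTraceNormal a) (i j : Fin 3) : a i j 0 = a j i 0 := by
  rw [h.form_eq i j, h.form_eq j i, Finset.sum_comm]
  simp only [mul_comm]

theorem cube_eq (h : IsTraceNormal a) (i : Fin 3) :
    ∑ k, a i i k * a k i 0 = ∑ k, ∑ l, ∑ m, a l i k * a m i l * a k i m := by
  have h1 := h.trace_cube (Pi.single i 1)
  rw [mulSC_eq_mulVec a (mulSC _ _ _)] at h1
  simp only [Matrix.trace, Matrix.diag, Matrix.mul_apply, rightAdj, Pi.single_apply, mulVec,
    dotProduct, mulSC_single_single, Matrix.of_apply, mul_ite, mul_one,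
    mul_zero, Finset.sum_ite_eq', Finset.mem_univ, if_true, Finset.sum_mul] at h1
  rw [show ∑ k, a i i k * a k i 0 = ∑ k, a k i 0 * a i i k from
    Finset.sum_congr rfl fun _ _ => mul_comm _ _, ← h1]
  exact Finset.sum_congr rfl fun _ _ => Finset.sum_comm

theorem exists_change (h : IsTraceNormal a) (p q r u v w : ℝ) (hQ : q * w - r * v ≠ 0) :
    ∃ b, IsTraceNormal b ∧ (IsModel3 b → IsModel3 a) ∧ ∀ i j k,
      ∑ l, !![1, 0, 0; p, q, r; u, v, w] k l * b i j l =
        ∑ l, ∑ m, a l m k * !![1, 0, 0; p, q, r; u, v, w] l i *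
          !![1, 0, 0; p, q, r; u, v, w] m j := by
  obtain ⟨b, hb, hn, hm, ht, hQ⟩ := exists_changeBasis h.isLSA h.diffNonDeg
    !![1, 0, 0; p, q, r; u, v, w] (by rw [Matrix.det_fin_three]; simpa using hQ)
  refine ⟨b, ⟨hb, hn, fun x => ?_⟩, hm, fun i j k => ?_⟩
  · rw [ht, h.trace_eq]
    simp [mulVec, dotProduct, Fin.sum_univ_three]
  · have h1 := congrFun (hQ (Pi.single i 1) (Pi.single j 1)) k
    rw [Matrix.mulVec_single_one, Matrix.mulVec_single_one] at h1
    simp only [mulVec, dotProduct, mulSC_single_single] at h1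
    exact h1

end IsTraceNormal

theorem exists_isTraceNormal {a : Fin 3 → Fin 3 → Fin 3 → ℝ} (hL : IsLSA a) (hN : DiffNonDeg a) :
    ∃ b, IsTraceNormal b ∧ (IsModel3 b → IsModel3 a) := by
  have key : ∀ Q : Matrix (Fin 3) (Fin 3) ℝ, Q.det ≠ 0 →
      (∀ x, (rightAdj a (Q *ᵥ x)).trace = x 0) → ∃ b, IsTraceNormal b ∧ (IsModel3 b → IsModel3 a) := by
    intro Q hQ hx
    obtain ⟨b, hb, hn, hm, ht, -⟩ := exists_changeBasis hL hN Q hQ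
    exact ⟨b, ⟨hb, hn, fun x => (ht x).trans (hx x)⟩, hm⟩
  let τ : Fin 3 → ℝ := fun j => a 0 j 0 + a 1 j 1 + a 2 j 2
  have hτ : ∀ x, (rightAdj a x).trace = τ 0 * x 0 + τ 1 * x 1 + τ 2 * x 2 := by
    intro x
    simp only [Matrix.trace_fin_three, rightAdj, Matrix.of_apply, Fin.sum_univ_three, τ]
    ring
  by_cases h0 : τ 0 = 0
  · by_cases h1 : τ 1 = 0
    · by_cases h2 : τ 2 = 0
      · have := hN.eq_zero_of_eval_trace (.X 0) fun x => by simp [hτ, h0, h1, h2]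
        exact absurd this (MvPolynomial.X_ne_zero 0)
      · refine key !![0, 1, 0; 0, 0, 1; 1 / τ 2, -τ 0 / τ 2, -τ 1 / τ 2] ?_ fun x => ?_
        · rw [Matrix.det_fin_three]; simpa using h2
        · rw [hτ]; simp [mulVec, dotProduct, Fin.sum_univ_three]; field_simp; ring
    · refine key !![0, 1, 0; 1 / τ 1, -τ 0 / τ 1, -τ 2 / τ 1; 0, 0, 1] ?_ fun x => ?_
      · rw [Matrix.det_fin_three]; simpa using h1
      · rw [hτ]; simp [mulVec, dotProduct, Fin.sum_univ_three]; field_simp; ring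
  · refine key !![1 / τ 0, -τ 1 / τ 0, -τ 2 / τ 0; 0, 1, 0; 0, 0, 1] ?_ fun x => ?_
    · rw [Matrix.det_fin_three]; simpa using h0
    · rw [hτ]; simp [mulVec, dotProduct, Fin.sum_univ_three]; field_simp; ring

namespace IsTraceNormal

variable {a : Fin 3 → Fin 3 → Fin 3 → ℝ}

theorem form_zero_two_of_isotropic (h : IsTraceNormal a) (h1 : a 1 2 0 = 0) (h2 : a 2 2 0 = 0) :
    a 0 2 0 = 0 := by
  have e1 := h.sum_eq 2
  have e2 := h.form_eq 2 2
  have e3 := h.cube_eq 2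
  simp only [Fin.sum_univ_three, h1, h2] at e1 e2 e3
  have : a 0 2 0 ^ 3 = 0 := by grind
  simpa using this

theorem form_zero_one_of_isotropic (h : IsTraceNormal a) (h1 : a 2 1 0 = 0) (h2 : a 1 1 0 = 0) :
    a 0 1 0 = 0 := by
  have e1 := h.sum_eq 1
  have e2 := h.form_eq 1 1
  have e3 := h.cube_eq 1
  simp only [Fin.sum_univ_three, h1, h2] at e1 e2 e3
  have : a 0 1 0 ^ 3 = 0 := by grind
  simpa using this

theorem exists_form_one_two_eq_zero (h : IsTraceNormal a) :
    ∃ b, IsTraceNormal b ∧ (IsModel3 b → IsModel3 a) ∧ b 1 2 0 = 0 := by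
  have hc := h.form_comm 1 2
  have key : ∀ q r v w : ℝ, q * w - r * v ≠ 0 →
      (a 1 1 0 * q * r + a 1 2 0 * (q * w + r * v) + a 2 2 0 * v * w = 0) →
      ∃ b, IsTraceNormal b ∧ (IsModel3 b → IsModel3 a) ∧ b 1 2 0 = 0 := by
    intro q r v w hQ he
    obtain ⟨b, hb, hm, hQ⟩ := h.exists_change 0 q r 0 v w hQ
    refine ⟨b, hb, hm, ?_⟩
    have := hQ 1 2 0
    simp [Fin.sum_univ_three] at this
    grind
  by_cases h1 : a 1 1 0 = 0
  · by_cases h2 : a 2 2 0 = 0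
    · refine key 1 1 1 (-1) (by norm_num) ?_
      rw [h1, h2]; ring
    · refine key 1 0 (-a 1 2 0 / a 2 2 0) 1 (by norm_num) ?_
      field_simp; ring
  · refine key 1 (-a 1 2 0 / a 1 1 0) 0 1 (by norm_num) ?_
    field_simp; ring

theorem exists_form_diagonal (h : IsTraceNormal a) :
    ∃ b, IsTraceNormal b ∧ (IsModel3 b → IsModel3 a) ∧
      b 1 2 0 = 0 ∧ b 0 1 0 = 0 ∧ b 0 2 0 = 0 := by
  obtain ⟨c, hc, hm, h12⟩ := h.exists_form_one_two_eq_zero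
  have h21 : c 2 1 0 = 0 := (hc.form_comm 2 1).trans h12
  obtain ⟨p, hp⟩ : ∃ p, c 0 1 0 + p * c 1 1 0 = 0 := by
    by_cases h1 : c 1 1 0 = 0
    · exact ⟨0, by rw [hc.form_zero_one_of_isotropic h21 h1]; ring⟩
    · exact ⟨-c 0 1 0 / c 1 1 0, by field_simp; ring⟩
  obtain ⟨u, hu⟩ : ∃ u, c 0 2 0 + u * c 2 2 0 = 0 := by
    by_cases h1 : c 2 2 0 = 0
    · exact ⟨0, by rw [hc.form_zero_two_of_isotropic h12 h1]; ring⟩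
    · exact ⟨-c 0 2 0 / c 2 2 0, by field_simp; ring⟩
  obtain ⟨b, hb, hm', hQ⟩ := hc.exists_change p 1 0 u 0 1 (by norm_num)
  refine ⟨b, hb, hm ∘ hm', ?_, ?_, ?_⟩
  · have := hQ 1 2 0
    simp [Fin.sum_univ_three] at this
    grind
  · have := hQ 0 1 0
    simp [Fin.sum_univ_three] at this
    grind
  · have := hQ 0 2 0
    simp [Fin.sum_univ_three] at this
    grind

end IsTraceNormal

/-- A trace-normal algebra whose trace form is diagonal with entries `α, s, t`. -/
structure IsDiagonalFrame (a : Fin 3 → Fin 3 → Fin 3 → ℝ) (α s t : ℝ) : Prop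
    extends IsTraceNormal a where
  form_zero_zero : a 0 0 0 = α
  form_zero_one : a 0 1 0 = 0
  form_zero_two : a 0 2 0 = 0
  form_one_zero : a 1 0 0 = 0
  form_one_one : a 1 1 0 = s
  form_one_two : a 1 2 0 = 0
  form_two_zero : a 2 0 0 = 0
  form_two_one : a 2 1 0 = 0
  form_two_two : a 2 2 0 = t

theorem IsTraceNormal.isDiagonalFrame {a : Fin 3 → Fin 3 → Fin 3 → ℝ} (h : IsTraceNormal a)
    (h12 : a 1 2 0 = 0) (h01 : a 0 1 0 = 0) (h02 : a 0 2 0 = 0) :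
    IsDiagonalFrame a (a 0 0 0) (a 1 1 0) (a 2 2 0) :=
  { h with
    form_zero_zero := rfl
    form_zero_one := h01
    form_zero_two := h02
    form_one_zero := (h.form_comm 1 0).trans h01
    form_one_one := rfl
    form_one_two := h12
    form_two_zero := (h.form_comm 2 0).trans h02
    form_two_one := (h.form_comm 2 1).trans h12
    form_two_two := rfl }

theorem IsTraceNormal.not_eval_eq_zero {a : Fin 3 → Fin 3 → Fin 3 → ℝ} (h : IsTraceNormal a)
    (P : MvPolynomial (Fin 3) ℝ) (v : Fin 3 → ℝ) (hv : MvPolynomial.eval v P ≠ 0) :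
    ¬ ∀ x, MvPolynomial.eval ![x 0, mulSC a x x 0, mulSC a (mulSC a x x) x 0] P = 0 := by
  intro hP
  have := h.diffNonDeg.eq_zero_of_eval_trace P fun x => by
    rw [h.trace_eq, h.trace_sq, h.trace_cube, hP]
  rw [this, map_zero] at hv
  exact hv rfl

namespace IsDiagonalFrame

variable {a : Fin 3 → Fin 3 → Fin 3 → ℝ} {α s t : ℝ}

theorem mulSC_zero (h : IsDiagonalFrame a α s t) (ξ η : Fin 3 → ℝ) :
    mulSC a ξ η 0 = α * ξ 0 * η 0 + s * ξ 1 * η 1 + t * ξ 2 * η 2 := by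
  simp only [mulSC, Fin.sum_univ_three, h.form_zero_zero, h.form_zero_one, h.form_zero_two,
    h.form_one_zero, h.form_one_one, h.form_one_two, h.form_two_zero, h.form_two_one,
    h.form_two_two]
  ring

/-- The symmetry of the associator paired with the trace form. -/
theorem associator_form (h : IsDiagonalFrame a α s t) :
    s * a 0 0 1 = 0 ∧ t * a 0 0 2 = 0 ∧
    s * (2 * a 0 1 1 - a 1 0 1 - α) = 0 ∧ t * (2 * a 0 2 2 - a 2 0 2 - α) = 0 ∧
    t * a 0 1 2 = t * a 1 0 2 - s * a 0 2 1 ∧ s * a 0 2 1 = s * a 2 0 1 - t * a 0 1 2 ∧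
    s * (a 1 2 1 - 2 * a 2 1 1) = - (t * a 1 1 2) ∧
    t * (2 * a 1 2 2 - a 2 1 2) = s * a 2 2 1 ∧ s * a 2 0 1 = t * a 1 0 2 := by
  have key := fun i j l => h.isLSA.structureConstants i j l 0
  have e1 := key 0 1 0
  have e2 := key 0 2 0
  have e3 := key 0 1 1
  have e4 := key 0 2 2
  have e5 := key 0 1 2
  have e6 := key 0 2 1
  have e7 := key 1 2 1
  have e8 := key 1 2 2
  have e9 := key 1 2 0
  simp only [h.form_zero_zero, h.form_zero_one, h.form_zero_two,
    h.form_one_zero, h.form_one_one, h.form_one_two, h.form_two_zero, h.form_two_one,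
    h.form_two_two] at e1 e2 e3 e4 e5 e6 e7 e8 e9
  refine ⟨?_, ?_, ?_, ?_, ?_, ?_, ?_, ?_, ?_⟩ <;> linarith

theorem form_two_two_ne_zero (h : IsDiagonalFrame a α s t) : t ≠ 0 := by
  rintro rfl
  obtain ⟨h1, -, h3, -, h5, h6, h7, h8, -⟩ := h.associator_form
  by_cases hs : s = 0
  · subst hs
    refine h.not_eval_eq_zero (.X 1 - .C α * .X 0 ^ 2) ![0, 1, 0] (by simp) fun x => ?_
    simp [h.mulSC_zero]
    ring
  · have f1 : a 0 0 1 = 0 := by simpa [hs] using h1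
    have f2 : a 0 2 1 = 0 := by simpa [hs] using h5
    have f3 : a 2 0 1 = 0 := by simpa [hs, f2] using h6
    have f4 : a 2 2 1 = 0 := by simpa [hs] using h8
    have f5 : a 1 2 1 = 2 * a 2 1 1 := by simpa [hs, sub_eq_zero] using h7
    have f6 : a 2 2 2 = - a 1 2 1 := by
      have := h.sum_eq 2
      simp [h.form_zero_two] at this
      linarith
    have f7 : a 1 2 1 = 0 := by
      have := h.form_eq 2 2
      simp only [Fin.sum_univ_three, h.form_zero_two, h.form_one_two, h.form_two_two, f2, f4,
        f6] at this
      have : a 1 2 1 ^ 2 = 0 := by linarith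
      simpa using this
    have f8 : a 2 1 1 = 0 := by linarith
    refine h.not_eval_eq_zero ((.X 2 - .C α * .X 0 * .X 1 - .C (a 0 1 1 + a 1 0 1) * .X 0 *
      (.X 1 - .C α * .X 0 ^ 2)) ^ 2 - .C (a 1 1 1 ^ 2 / s) * (.X 1 - .C α * .X 0 ^ 2) ^ 3)
      ![0, 0, 1] (by simp) fun x => ?_
    simp [h.mulSC_zero]
    simp only [mulSC, Fin.sum_univ_three, f1, f2, f3, f4, f7, f8]
    field_simp
    ring

theorem swap (h : IsDiagonalFrame a α s t) :
    ∃ b, IsDiagonalFrame b α t s ∧ (IsModel3 b → IsModel3 a) ∧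
      b 1 0 1 = a 2 0 2 ∧ b 2 0 2 = a 1 0 1 ∧ b 1 0 2 = a 2 0 1 ∧ b 2 0 1 = a 1 0 2 := by
  obtain ⟨b, hb, hm, hQ⟩ := h.exists_change 0 0 1 0 1 0 (by norm_num)
  have hQ0 := fun i j => hQ i j 0
  have hQ1 := fun i j => hQ i j 1
  have hQ2 := fun i j => hQ i j 2
  simp [Fin.sum_univ_three] at hQ0 hQ1 hQ2
  refine ⟨b, ⟨hb, ?_, ?_, ?_, ?_, ?_, ?_, ?_, ?_, ?_⟩, hm, ?_, ?_, ?_, ?_⟩ <;>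
  simp [hQ0, hQ1, hQ2, h.form_zero_zero, h.form_zero_one, h.form_zero_two,
    h.form_one_zero, h.form_one_one, h.form_one_two, h.form_two_zero, h.form_two_one,
    h.form_two_two]

theorem form_one_one_ne_zero (h : IsDiagonalFrame a α s t) : s ≠ 0 := by
  obtain ⟨b, hb, -⟩ := h.swap
  exact hb.form_two_two_ne_zero

end IsDiagonalFrame

theorem isModel3_of_matrix {a : Fin 3 → Fin 3 → Fin 3 → ℝ} (m : Fin 8)
    (P : Matrix (Fin 3) (Fin 3) ℝ) (hP : P.det ≠ 0)
    (h : ∀ i j k, ∑ l, P k l * a i j l =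
      ∑ l, models3 m (fun q => P q j) k l * P l i) : IsModel3 a := by
  have hu : IsUnit P.det := Ne.isUnit hP
  refine ⟨m, Matrix.toLinearEquiv' P (Matrix.invertibleOfIsUnitDet P hu), fun ξ η => ?_⟩
  change P *ᵥ mulSC a ξ η = mulSC _ (P *ᵥ ξ) (P *ᵥ η)
  rw [mulSC_eq_mulVec, mulSC_eq_mulVec, Matrix.mulVec_mulVec, Matrix.mulVec_mulVec]
  have hc := rightAdj_scOfOp_models3 m
  generalize scOfOp (models3 m) = c at hc ⊢
  rw [← hc] at h
  congr 1
  ext k i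
  have h0 := h i 0 k
  have h1 := h i 1 k
  have h2 := h i 2 k
  simp only [rightAdj, Matrix.mul_apply, Fin.sum_univ_three,
    Matrix.of_apply, mulVec, dotProduct] at h0 h1 h2 ⊢
  linear_combination η 0 * h0 + η 1 * h1 + η 2 * h2

namespace IsDiagonalFrame

variable {a : Fin 3 → Fin 3 → Fin 3 → ℝ} {α s t : ℝ}

theorem zero_zero_one (h : IsDiagonalFrame a α s t) : a 0 0 1 = 0 := by
  simpa [h.form_one_one_ne_zero] using h.associator_form.1

theorem zero_zero_two (h : IsDiagonalFrame a α s t) : a 0 0 2 = 0 := by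
  simpa [h.form_two_two_ne_zero] using h.associator_form.2.1

theorem trace_block (h : IsDiagonalFrame a α s t) : a 1 0 1 + a 2 0 2 = 1 - α := by
  have := h.sum_eq 0
  simp [h.form_zero_zero] at this
  linarith

theorem det_block (h : IsDiagonalFrame a α s t) :
    a 1 0 1 * a 2 0 2 - a 1 0 2 * a 2 0 1 = (1 - α) * (1 - 2 * α) / 2 := by
  have h1 := h.trace_block
  have h2 := h.form_eq 0 0
  simp only [Fin.sum_univ_three, h.form_zero_zero, h.form_one_zero, h.form_two_zero,
    h.zero_zero_one, h.zero_zero_two] at h2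
  linear_combination (1/2) * (a 1 0 1 + a 2 0 2 + 1 - α) * h1 + (1/2) * h2

theorem form_zero_zero_cases (h : IsDiagonalFrame a α s t) : α = 1 ∨ α = 1 / 2 ∨ α = 1 / 3 := by
  have h1 := h.trace_block
  have h2 := h.det_block
  have h3 := h.cube_eq 0
  simp only [Fin.sum_univ_three, h.form_zero_zero, h.form_one_zero, h.form_two_zero,
    h.zero_zero_one, h.zero_zero_two] at h3
  have : (α - 1) * ((α - 1 / 2) * (α - 1 / 3)) = 0 := by grind
  simpa [sub_eq_zero] using this

theorem exists_orthogonal_change (h : IsDiagonalFrame a α s t) (q r v w : ℝ)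
    (hQ : q * w - r * v ≠ 0) (ho : s * q * r + t * v * w = 0) :
    ∃ b, IsDiagonalFrame b α (s * q ^ 2 + t * v ^ 2) (s * r ^ 2 + t * w ^ 2) ∧
      (IsModel3 b → IsModel3 a) ∧ ∀ i j k,
      ∑ l, !![1, 0, 0; 0, q, r; 0, v, w] k l * b i j l =
        ∑ l, ∑ m, a l m k * !![1, 0, 0; 0, q, r; 0, v, w] l i *
          !![1, 0, 0; 0, q, r; 0, v, w] m j := by
  obtain ⟨b, hb, hm, hQ⟩ := h.exists_change 0 q r 0 v w hQ
  have hQ0 := fun i j => hQ i j 0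
  simp [Fin.sum_univ_three] at hQ0
  refine ⟨b, ⟨hb, ?_, ?_, ?_, ?_, ?_, ?_, ?_, ?_, ?_⟩, hm, hQ⟩ <;>
  simp [hQ0, h.form_zero_zero, h.form_zero_one, h.form_zero_two,
    h.form_one_zero, h.form_one_one, h.form_one_two, h.form_two_zero, h.form_two_one,
    h.form_two_two] <;> linarith

theorem exists_block_half (h : IsDiagonalFrame a (1 / 2) s t) :
    ∃ b s' t', IsDiagonalFrame b (1 / 2) s' t' ∧ (IsModel3 b → IsModel3 a) ∧
      b 1 0 1 = 1 / 2 ∧ b 2 0 2 = 0 ∧ b 1 0 2 = 0 ∧ b 2 0 1 = 0 := by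
  have h1 := h.trace_block
  have h2 := h.det_block
  have hs := h.form_one_one_ne_zero
  have ht := h.form_two_two_ne_zero
  obtain ⟨-, -, -, -, -, -, -, -, h3⟩ := h.associator_form
  by_cases h0 : a 1 0 1 = 0
  · obtain ⟨b, hb, hm, e1, e2, e3, e4⟩ := h.swap
    refine ⟨b, t, s, hb, hm, ?_, ?_, ?_, ?_⟩
    · linarith
    · linarith
    · have : t * a 2 0 1 * a 1 0 2 = 0 := by grind
      have : s * b 1 0 2 ^ 2 = 0 := by grind
      simpa [hs] using this
    · have : t * b 2 0 1 ^ 2 = 0 := by grind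
      simpa [ht] using this
  · have hd : s * a 1 0 1 ^ 2 + t * a 1 0 2 ^ 2 ≠ 0 := by
      have : s * a 1 0 1 ^ 2 + t * a 1 0 2 ^ 2 = s * a 1 0 1 / 2 := by grind
      rw [this]
      positivity
    obtain ⟨b, hb, hm, hQ⟩ := h.exists_orthogonal_change (a 1 0 1) (-t * a 1 0 2) (a 1 0 2)
      (s * a 1 0 1) (by convert hd using 1; ring) (by ring)
    refine ⟨b, _, _, hb, hm, ?_⟩
    have e1 := hQ 1 0 1
    have e2 := hQ 1 0 2
    have e3 := hQ 2 0 1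
    have e4 := hQ 2 0 2
    simp [Fin.sum_univ_three, hb.form_one_zero, hb.form_two_zero] at e1 e2 e3 e4
    refine ⟨?_, ?_, ?_, ?_⟩ <;> apply mul_left_cancel₀ hd <;> grind

end IsDiagonalFrame

namespace IsDiagonalFrame

variable {a : Fin 3 → Fin 3 → Fin 3 → ℝ} {α s t : ℝ}

theorem isModel3_of_block_half (h : IsDiagonalFrame a (1 / 2) s t) (h11 : a 1 0 1 = 1 / 2)
    (h22 : a 2 0 2 = 0) (h21 : a 1 0 2 = 0) (h12 : a 2 0 1 = 0) : IsModel3 a := by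
  have hs := h.form_one_one_ne_zero
  have ht := h.form_two_two_ne_zero
  obtain ⟨-, -, l3, l4, l5, l6, l7, l8, -⟩ := h.associator_form
  have f011 : a 0 1 1 = 1 / 2 := by
    have := (mul_eq_zero.1 l3).resolve_left hs
    linarith
  have f022 : a 0 2 2 = 1 / 4 := by
    have := (mul_eq_zero.1 l4).resolve_left ht
    linarith
  have s1 := h.sum_eq 1
  have s2 := h.sum_eq 2
  have b01 := h.form_eq 0 1
  have b02 := h.form_eq 0 2
  have b11 := h.form_eq 1 1
  have b12 := h.form_eq 1 2
  have b22 := h.form_eq 2 2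
  simp [Fin.sum_univ_three, h.form_zero_zero, h.form_zero_one, h.form_zero_two,
    h.form_one_zero, h.form_one_one, h.form_one_two, h.form_two_zero, h.form_two_one,
    h.form_two_two, h.zero_zero_one, h.zero_zero_two, h11, h22, h12, h21, f011, f022]
    at s1 s2 b01 b02 b11 b12 b22 l5 l6
  have f111 : a 1 1 1 = 0 := by grind
  have f212 : a 2 1 2 = 0 := by grind
  have f121 : a 1 2 1 = 0 := by grind
  have f222 : a 2 2 2 = 0 := by grind
  simp [f111, f212, f121, f222] at b11 b12 b22 l7 l8
  have f211 : a 2 1 1 = 0 := by grind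
  have f112 : a 1 1 2 = 0 := by grind
  have f012 := h.isLSA.structureConstants 0 1 0 2
  have f021 := h.isLSA.structureConstants 0 2 0 1
  simp [h.form_zero_zero, h.form_zero_one, h.form_zero_two,
    h.form_one_zero, h.zero_zero_one, h.form_two_zero, h.zero_zero_two,
    h11, h22, h12, h21, f011, f022] at f012 f021
  have hd : a 2 2 1 ≠ 0 := by grind
  obtain ⟨l, hl⟩ : ∃ l, l = t / (4 * a 2 2 1) := ⟨_, rfl⟩
  have hl0 : l ≠ 0 := by rw [hl]; positivity
  have f221 : a 2 2 1 = t / (4 * l) := by grind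
  have f122 : a 1 2 2 = l := by grind
  have hs' : s = 8 * l ^ 2 := by grind
  subst hs'
  obtain ⟨m, hm⟩ : ∃ m, m = √(|t| / 2) := ⟨_, rfl⟩
  have hm0 : m ≠ 0 := by rw [hm]; positivity
  have hm2 : 2 * m ^ 2 = |t| := by rw [hm, Real.sq_sqrt (by positivity)]; ring
  have hdet : (!![1 / 4, l, 0; 0, 0, m; 1 / 2, -2 * l, 0] : Matrix (Fin 3) (Fin 3) ℝ).det ≠ 0 := by
    rw [Matrix.det_fin_three]
    have : m * l ≠ 0 := mul_ne_zero hm0 hl0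
    simp
    grind
  rcases lt_or_gt_of_ne ht with h0 | h0
  · obtain rfl : t = -(2 * m ^ 2) := by rw [hm2, abs_of_neg h0, neg_neg]
    refine isModel3_of_matrix 0 !![1 / 4, l, 0; 0, 0, m; 1 / 2, -2 * l, 0] hdet ?_
    rw [models3_zero]
    simp [Fin.forall_fin_succ, Fin.sum_univ_three, h.form_zero_zero, h.form_zero_one,
      h.form_zero_two, h.form_one_zero, h.form_one_one, h.form_one_two, h.form_two_zero,
      h.form_two_one, h.form_two_two, h.zero_zero_one, h.zero_zero_two, h11, h22, h12, h21, f011,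
      f022, f111, f212, f121, f222, f211, f112, f012, f021, f221, f122]
    grind
  · obtain rfl : t = 2 * m ^ 2 := by rw [hm2, abs_of_pos h0]
    refine isModel3_of_matrix 1 !![1 / 4, l, 0; 0, 0, m; 1 / 2, -2 * l, 0] hdet ?_
    rw [models3_one]
    simp [Fin.forall_fin_succ, Fin.sum_univ_three, h.form_zero_zero, h.form_zero_one,
      h.form_zero_two, h.form_one_zero, h.form_one_one, h.form_one_two, h.form_two_zero,
      h.form_two_one, h.form_two_two, h.zero_zero_one, h.zero_zero_two, h11, h22, h12, h21, f011,
      f022, f111, f212, f121, f222, f211, f112, f012, f021, f221, f122]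
    grind

end IsDiagonalFrame

/-- A trace-normal algebra whose trace form is `α x² + 2yz`. -/
structure IsNullFrame (a : Fin 3 → Fin 3 → Fin 3 → ℝ) (α : ℝ) : Prop
    extends IsTraceNormal a where
  form_zero_zero : a 0 0 0 = α
  form_zero_one : a 0 1 0 = 0
  form_zero_two : a 0 2 0 = 0
  form_one_zero : a 1 0 0 = 0
  form_one_one : a 1 1 0 = 0
  form_one_two : a 1 2 0 = 1
  form_two_zero : a 2 0 0 = 0
  form_two_one : a 2 1 0 = 1
  form_two_two : a 2 2 0 = 0

namespace IsDiagonalFrame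

variable {a : Fin 3 → Fin 3 → Fin 3 → ℝ} {α s t : ℝ}

theorem exists_isNullFrame (h : IsDiagonalFrame a α s t) {q v κ : ℝ} (hκ : 2 * s * q ^ 2 * κ = 1)
    (h0 : s * q ^ 2 + t * v ^ 2 = 0) :
    ∃ b, IsNullFrame b α ∧ (IsModel3 b → IsModel3 a) ∧ ∀ i j k,
      ∑ l, !![1, 0, 0; 0, q, q * κ; 0, v, -v * κ] k l * b i j l =
        ∑ l, ∑ m, a l m k * !![1, 0, 0; 0, q, q * κ;
          0, v, -v * κ] l i *
          !![1, 0, 0; 0, q, q * κ; 0, v, -v * κ] m j := by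
  have hs := h.form_one_one_ne_zero
  have ht := h.form_two_two_ne_zero
  have hq : q ≠ 0 := by rintro rfl; simp at hκ
  have hκ0 : κ ≠ 0 := by rintro rfl; simp at hκ
  have hv : v ≠ 0 := by
    rintro rfl
    have : s * q ^ 2 ≠ 0 := by positivity
    exact this (by linarith)
  obtain ⟨b, hb, hm, hQ⟩ := h.exists_change 0 q (q * κ) 0 v (-v * κ) (by
    have : q * v * κ ≠ 0 := by positivity
    grind)
  have hQ0 := fun i j => hQ i j 0
  simp [Fin.sum_univ_three] at hQ0
  refine ⟨b, ⟨hb, ?_, ?_, ?_, ?_, ?_, ?_, ?_, ?_, ?_⟩, hm, hQ⟩ <;>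
  simp [hQ0, h.form_zero_zero, h.form_zero_one, h.form_zero_two,
    h.form_one_zero, h.form_one_one, h.form_one_two, h.form_two_zero, h.form_two_one,
    h.form_two_two] <;> grind

/-- Every binary cubic of this shape has a non-trivial zero. -/
theorem exists_cubic_zero (a : Fin 3 → Fin 3 → Fin 3 → ℝ) (s t : ℝ) :
    ∃ y z : ℝ, y ^ 2 + z ^ 2 = 1 ∧
      s * y * (a 1 1 1 * (-t * z) * y + a 1 2 1 * (-t * z) * z + a 2 1 1 * (s * y) * y +
        a 2 2 1 * (s * y) * z) +
      t * z * (a 1 1 2 * (-t * z) * y + a 1 2 2 * (-t * z) * z + a 2 1 2 * (s * y) * y +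
        a 2 2 2 * (s * y) * z) = 0 := by
  let F : ℝ → ℝ → ℝ := fun y z =>
      s * y * (a 1 1 1 * (-t * z) * y + a 1 2 1 * (-t * z) * z + a 2 1 1 * (s * y) * y +
        a 2 2 1 * (s * y) * z) +
      t * z * (a 1 1 2 * (-t * z) * y + a 1 2 2 * (-t * z) * z + a 2 1 2 * (s * y) * y +
        a 2 2 2 * (s * y) * z)
  have hc : Continuous fun θ => F (Real.cos θ) (Real.sin θ) := by
    simp only [F]
    fun_prop
  have hF : F (Real.cos Real.pi) (Real.sin Real.pi) = -F (Real.cos 0) (Real.sin 0) := by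
    simp only [F, Real.cos_pi, Real.sin_pi, Real.cos_zero, Real.sin_zero]
    ring
  obtain ⟨θ, hθ⟩ : (0 : ℝ) ∈ Set.range fun θ => F (Real.cos θ) (Real.sin θ) := by
    rcases le_total (F (Real.cos 0) (Real.sin 0)) 0 with h0 | h0
    · exact mem_range_of_exists_le_of_exists_ge hc ⟨0, h0⟩ ⟨Real.pi, by simp only [hF]; linarith⟩
    · exact mem_range_of_exists_le_of_exists_ge hc ⟨Real.pi, by simp only [hF]; linarith⟩ ⟨0, h0⟩
  exact ⟨Real.cos θ, Real.sin θ, Real.cos_sq_add_sin_sq θ, hθ⟩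

theorem exists_reduced_frame (h : IsDiagonalFrame a α s t) (hα : α ≠ 1 / 2) :
    ∃ b, (IsModel3 b → IsModel3 a) ∧
      ((∃ s' t', IsDiagonalFrame b α s' t' ∧ b 1 0 1 = (1 - α) / 2 ∧ b 2 0 2 = (1 - α) / 2 ∧
        b 1 0 2 = 0 ∧ b 2 0 1 = 0 ∧ b 2 1 1 = 0) ∨
      (IsNullFrame b α ∧ b 1 0 1 = (1 - α) / 2 ∧ b 2 0 2 = (1 - α) / 2 ∧ b 1 0 2 = 0 ∧
        (b 2 0 1 = 0 → b 1 1 2 = 0))) := by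
  have h1 := h.trace_block
  have h2 := h.det_block
  have hs := h.form_one_one_ne_zero
  have ht := h.form_two_two_ne_zero
  have h4 : (α - 1) * (α - 1 / 3) = 0 := by
    rcases h.form_zero_zero_cases with h | h | h
    · simp [h]
    · exact absurd h hα
    · simp [h]
  obtain ⟨-, -, -, -, -, -, -, -, h3⟩ := h.associator_form
  have hM : s * (a 1 0 1 - (1 - α) / 2) ^ 2 + t * a 1 0 2 ^ 2 = 0 := by grind
  by_cases h0 : a 1 0 1 = (1 - α) / 2
  · have h21 : a 1 0 2 = 0 := by
      rw [h0, sub_self] at hM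
      simpa [ht] using hM
    have h12 : a 2 0 1 = 0 := by
      rw [h21] at h3
      simpa [hs] using h3
    have h22 : a 2 0 2 = (1 - α) / 2 := by linarith
    obtain ⟨y, z, hyz, hF⟩ := exists_cubic_zero a s t
    by_cases hq : s * y ^ 2 + t * z ^ 2 = 0
    · have hy : y ≠ 0 := by
        rintro rfl
        grind
      obtain ⟨κ, hκ⟩ : ∃ κ, 2 * s * y ^ 2 * κ = 1 := ⟨_, mul_inv_cancel₀ (by positivity)⟩
      obtain ⟨b, hb, hm, hQ⟩ := h.exists_isNullFrame hκ hq
      have e1 := hQ 1 0 1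
      have e2 := hQ 1 0 2
      have e3 := hQ 2 0 1
      have e4 := hQ 2 0 2
      have e5 := hQ 1 1 1
      have e6 := hQ 1 1 2
      simp [Fin.sum_univ_three, hb.form_one_zero, hb.form_two_zero, hb.form_one_one, h12, h21, h22,
        h0] at e1 e2 e3 e4 e5 e6
      have hz : z ≠ 0 := by
        rintro rfl
        grind
      refine ⟨b, hm, .inr ⟨hb, ?_, ?_, ?_, fun _ => ?_⟩⟩
      · grind
      · grind
      · grind
      · have : t * z * b 1 1 2 = 0 := by
          linear_combination t * z * (s * y * e5 + t * z * e6) - y * hF - t * z * b 1 1 2 * hκ +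
            (s * y * (a 2 1 1 * y + a 2 2 1 * z) + t * z * (a 2 1 2 * y + a 2 2 2 * z)
              - t * z * b 1 1 1 + t * z * κ * b 1 1 2) * hq
        simpa [ht, hz] using this
    · obtain ⟨b, hb, hm, hQ⟩ := h.exists_orthogonal_change y (-t * z) z (s * y)
        (by convert hq using 1; ring) (by ring)
      have e1 := hQ 1 0 1
      have e2 := hQ 1 0 2
      have e3 := hQ 2 0 1
      have e4 := hQ 2 0 2
      have e5 := hQ 2 1 1
      have e6 := hQ 2 1 2
      simp [Fin.sum_univ_three, hb.form_one_zero, hb.form_two_zero, hb.form_two_one, h12, h21, h22,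
        h0] at e1 e2 e3 e4 e5 e6
      refine ⟨b, hm, .inl ⟨_, _, hb, ?_, ?_, ?_, ?_, ?_⟩⟩ <;> apply mul_left_cancel₀ hq
      · grind
      · grind
      · grind
      · grind
      · linear_combination s * y * e5 + t * z * e6 + hF
  · obtain ⟨κ, hκ⟩ : ∃ κ, 2 * s * (a 1 0 1 - (1 - α) / 2) ^ 2 * κ = 1 :=
      have := sub_ne_zero.2 h0
      ⟨_, mul_inv_cancel₀ (by positivity)⟩
    obtain ⟨b, hb, hm, hQ⟩ := h.exists_isNullFrame hκ hM
    have e1 := hQ 1 0 1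
    have e2 := hQ 1 0 2
    have e3 := hQ 2 0 1
    have e4 := hQ 2 0 2
    simp [Fin.sum_univ_three, hb.form_one_zero, hb.form_two_zero] at e1 e2 e3 e4
    have hz : a 1 0 2 ≠ 0 := by
      intro hz
      apply h0
      have : s * (a 1 0 1 - (1 - α) / 2) ^ 2 = 0 := by rw [hz] at hM; linarith
      simpa [hs, sub_eq_zero] using this
    refine ⟨b, hm, .inr ⟨hb, ?_, ?_, ?_, fun hn => ?_⟩⟩
    · grind
    · grind
    · grind
    · exfalso
      grind

end IsDiagonalFrame

theorem exists_pow_three_eq (c : ℝ) : ∃ m : ℝ, m ^ 3 = c := by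
  have key : ∀ c : ℝ, 0 ≤ c → ∃ m : ℝ, m ^ 3 = c := fun c hc =>
    ⟨c ^ (1 / 3 : ℝ), by rw [← Real.rpow_natCast, ← Real.rpow_mul hc]; norm_num⟩
  rcases le_total 0 c with hc | hc
  · exact key c hc
  · obtain ⟨m, hm⟩ := key (-c) (by linarith)
    exact ⟨-m, by rw [Odd.neg_pow (by decide), hm, neg_neg]⟩

namespace IsNullFrame

variable {a : Fin 3 → Fin 3 → Fin 3 → ℝ} {α : ℝ}

theorem mulSC_zero (h : IsNullFrame a α) (ξ η : Fin 3 → ℝ) :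
    mulSC a ξ η 0 = α * ξ 0 * η 0 + ξ 1 * η 2 + ξ 2 * η 1 := by
  simp only [mulSC, Fin.sum_univ_three, h.form_zero_zero, h.form_zero_one, h.form_zero_two,
    h.form_one_zero, h.form_one_one, h.form_one_two, h.form_two_zero, h.form_two_one,
    h.form_two_two]
  ring

/-- The symmetry of the associator paired with the trace form. -/
theorem associator_form (h : IsNullFrame a α) :
    a 0 0 1 = 0 ∧ a 0 0 2 = 0 ∧ a 1 0 2 = 2 * a 0 1 2 ∧ a 2 0 1 = 2 * a 0 2 1 ∧
    a 0 2 2 = a 1 0 1 + α - a 0 1 1 ∧ a 2 0 2 = a 1 0 1 ∧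
    a 1 2 2 = 2 * a 2 1 2 - a 1 1 1 ∧ a 2 1 1 = 2 * a 1 2 1 - a 2 2 2 := by
  have key := fun i j l => h.isLSA.structureConstants i j l 0
  have e1 := key 0 1 0
  have e2 := key 0 2 0
  have e3 := key 0 1 1
  have e4 := key 0 2 2
  have e5 := key 0 1 2
  have e6 := key 1 2 0
  have e7 := key 1 2 1
  have e8 := key 1 2 2
  simp only [h.form_zero_zero, h.form_zero_one, h.form_zero_two,
    h.form_one_zero, h.form_one_one, h.form_one_two, h.form_two_zero, h.form_two_one,
    h.form_two_two] at e1 e2 e3 e4 e5 e6 e7 e8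
  refine ⟨?_, ?_, ?_, ?_, ?_, ?_, ?_, ?_⟩ <;> linarith

theorem isModel3 (h : IsNullFrame a α) (hα : α ≠ 1 / 2) (h11 : a 1 0 1 = (1 - α) / 2)
    (h22 : a 2 0 2 = (1 - α) / 2) (h21 : a 1 0 2 = 0)
    (hν : a 2 0 1 = 0 → a 1 1 2 = 0) : IsModel3 a := by
  obtain ⟨f001, f002, l1, l2, l3, -, l4, l5⟩ := h.associator_form
  have f012 : a 0 1 2 = 0 := by linarith
  have s1 := h.sum_eq 1
  have s2 := h.sum_eq 2
  have b00 := h.form_eq 0 0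
  have b01 := h.form_eq 0 1
  have b02 := h.form_eq 0 2
  have b11 := h.form_eq 1 1
  have b12 := h.form_eq 1 2
  have b22 := h.form_eq 2 2
  simp [Fin.sum_univ_three, h.form_zero_zero, h.form_zero_one, h.form_zero_two,
    h.form_one_zero, h.form_one_one, h.form_one_two, h.form_two_zero, h.form_two_one,
    h.form_two_two, f001, f002, f012, h11, h22, h21, l2, l3, l4, l5]
    at s1 s2 b00 b01 b02 b11 b12 b22 hν
  have f112 : a 1 1 2 = 0 := by
    by_contra hc
    have : a 0 2 1 * a 1 1 2 = 0 := by grind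
    grind
  have f212 : a 2 1 2 = -a 1 1 1 := by linarith
  have f111 : a 1 1 1 = 0 := by
    have : a 1 1 1 ^ 2 = 0 := by
      rw [f112, f212] at b11
      linarith
    simpa using this
  rw [f111, neg_zero] at f212
  obtain rfl : α = 1 := by
    rw [f111, f112, f212] at b12
    linarith
  have f222 : a 2 2 2 = -a 1 2 1 := by linarith
  have f021 : a 0 2 1 = -a 1 2 1 ^ 2 := by
    rw [f111, f212, f222] at b22
    linarith
  have f101 : a 1 0 1 = 0 := by rw [h11]; norm_num
  have f202 : a 2 0 2 = 0 := by rw [h22]; norm_num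
  have f201 : a 2 0 1 = -2 * a 1 2 1 ^ 2 := by rw [l2, f021]; ring
  have f022 : a 0 2 2 = 1 - a 0 1 1 := by rw [l3, f101]; ring
  have f122 : a 1 2 2 = 0 := by rw [l4, f212, f111]; ring
  have f211 : a 2 1 1 = 3 * a 1 2 1 := by rw [l5, f222]; ring
  have g1 := h.isLSA.structureConstants 0 1 2 1
  have g2 := h.isLSA.structureConstants 0 2 2 1
  simp [h.form_zero_one, h.form_zero_two, h.form_one_zero, h.form_one_two, h.form_two_zero,
    h.form_two_two, f001, f012, f101, f202, h21, f201, f022, f122, f211, f111, f222, f021]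
    at g1 g2
  by_cases hk : a 1 2 1 = 0
  · have hc : a 2 2 1 ≠ 0 := by
      intro hc
      refine h.not_eval_eq_zero (2 * .X 2 - 3 * .X 0 * .X 1 + .X 0 ^ 3) ![0, 0, 1] (by simp)
        fun x => ?_
      simp [h.mulSC_zero]
      simp [mulSC, Fin.sum_univ_three, f001, f002, f012, f101, f202, h21, f201, f022, f122, f211, f111, f212,
        f222, f112, f021, hk, hc]
      ring
    have f011 : a 0 1 1 = 2 / 3 := by grind
    obtain ⟨m, hm⟩ : ∃ m : ℝ, m ^ 3 = -a 2 2 1 :=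
      exists_pow_three_eq _
    have hm0 : m ≠ 0 := by grind
    refine isModel3_of_matrix 7 !![-1, 0, 0; 0, -1 / m, 0; 0, 0, m] ?_ ?_
    · rw [Matrix.det_fin_three]
      simp
      grind
    rw [models3_seven]
    simp [Fin.forall_fin_succ, Fin.sum_univ_three, h.form_zero_zero, h.form_zero_one,
      h.form_zero_two, h.form_one_zero, h.form_one_one, h.form_one_two, h.form_two_zero,
      h.form_two_one, h.form_two_two, f001, f002, f012, f101, f202, h21, f201, f022, f122, f211, f111, f212,
        f222, f112, f021, hk, f011]
    grind
  · have f011 : a 0 1 1 = 1 := by grind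
    have f221 : a 2 2 1 = -3 * a 1 2 1 ^ 3 := by grind
    refine isModel3_of_matrix 6 !![1, 0, a 1 2 1; -1, 1 / a 1 2 1, -a 1 2 1; 0, 0, -a 1 2 1] ?_ ?_
    · rw [Matrix.det_fin_three]
      simp
      grind
    rw [models3_six]
    simp [Fin.forall_fin_succ, Fin.sum_univ_three, h.form_zero_zero, h.form_zero_one,
      h.form_zero_two, h.form_one_zero, h.form_one_one, h.form_one_two, h.form_two_zero,
      h.form_two_one, h.form_two_two, f001, f002, f012, f101, f202, h21, f201, f022, f122, f211, f111, f212,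
        f222, f112, f021, f011, f221]
    grind

end IsNullFrame

namespace IsDiagonalFrame

variable {a : Fin 3 → Fin 3 → Fin 3 → ℝ} {α s t : ℝ}

theorem isModel3_of_scalar (h : IsDiagonalFrame a α s t) (hα : α = 1 ∨ α = 1 / 3)
    (h11 : a 1 0 1 = (1 - α) / 2) (h22 : a 2 0 2 = (1 - α) / 2) (h21 : a 1 0 2 = 0)
    (h12 : a 2 0 1 = 0) (f211 : a 2 1 1 = 0) : IsModel3 a := by
  have hs := h.form_one_one_ne_zero
  have ht := h.form_two_two_ne_zero
  obtain ⟨-, -, l3, l4, l5, l6, l7, l8, -⟩ := h.associator_form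
  have f011 : a 0 1 1 = (1 + α) / 4 := by
    have := (mul_eq_zero.1 l3).resolve_left hs
    linarith
  have f022 : a 0 2 2 = (1 + α) / 4 := by
    have := (mul_eq_zero.1 l4).resolve_left ht
    linarith
  have s1 := h.sum_eq 1
  have s2 := h.sum_eq 2
  have b11 := h.form_eq 1 1
  have b12 := h.form_eq 1 2
  have b22 := h.form_eq 2 2
  simp [Fin.sum_univ_three, h.form_zero_one, h.form_zero_two, h.form_one_one, h.form_one_two,
    h.form_two_one, h.form_two_two, h21, f011, f022, f211] at s1 s2 b11 b12 b22 l5 l7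
  have f222 : a 2 2 2 = -a 1 2 1 := by linarith
  rcases hα with rfl | rfl
  · norm_num at h11 h22 f011 f022
    exfalso
    have f111 : a 1 1 1 = 0 := by
      have : a 1 1 1 ^ 2 = 0 := by grind
      simpa using this
    have f212 : a 2 1 2 = 0 := by linarith
    have hc : a 1 2 1 * a 2 2 1 = 0 := by grind
    have f121 : a 1 2 1 = 0 := by grind
    have f221 : a 2 2 1 = 0 := by grind
    have f112 : a 1 1 2 = 0 := by grind
    have f122 : a 1 2 2 = 0 := by grind
    refine h.not_eval_eq_zero (2 * .X 2 - 3 * .X 0 * .X 1 + .X 0 ^ 3) ![0, 0, 1] (by simp)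
      fun x => ?_
    simp [h.mulSC_zero]
    simp [mulSC, Fin.sum_univ_three, h.zero_zero_one, h.zero_zero_two, h11, h22, h12, h21, f011,
      f022, f111, f212, f121, f222, f211, f112, f221, f122]
    linear_combination 2 * x 0 * x 1 * x 2 * l5
  have f101 : a 1 0 1 = 1 / 3 := by rw [h11]; norm_num
  have f202 : a 2 0 2 = 1 / 3 := by rw [h22]; norm_num
  norm_num at f011 f022
  have hk : s = 6 * a 1 1 1 ^ 2 := by grind
  have f121 : a 1 2 1 = 0 := by
    by_contra hc
    have : t * (2 * a 1 1 1) = s * a 2 2 1 := by grind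
    grind
  have f112 : a 1 1 2 = 0 := by grind
  rw [f121, neg_zero] at f222
  have hu : s * a 2 2 1 = -(t * a 1 1 1) ∨ s * a 2 2 1 = t * (2 * a 1 1 1) := by grind
  have g3 := h.isLSA.structureConstants 0 1 2 1
  have g8 := h.isLSA.structureConstants 0 2 1 1
  simp [h.form_zero_one, h.form_zero_two, h.form_one_zero, h.form_one_two, h.form_two_zero,
    h.form_two_one, h.zero_zero_one,
    f101, f202, h12, h21, f011, f022, f211, f121] at g3 g8
  obtain ⟨m, hm⟩ : ∃ m, m = √(|t| / 2) := ⟨_, rfl⟩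
  have hm0 : m ≠ 0 := by rw [hm]; positivity
  have hm2 : 2 * m ^ 2 = |t| := by rw [hm, Real.sq_sqrt (by positivity)]; ring
  have hdet : ∀ l : ℝ, l ≠ 0 →
      (!![1 / 3, l, 0; 0, 0, m; 1 / 3, -2 * l, 0] : Matrix (Fin 3) (Fin 3) ℝ).det ≠ 0 := by
    intro l hl
    rw [Matrix.det_fin_three]
    have : m * l ≠ 0 := mul_ne_zero hm0 hl
    simp
    grind
  rcases hu with hu | hu
  · obtain ⟨l, hl⟩ : ∃ l, l = -a 1 1 1 := ⟨_, rfl⟩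
    have f111 : a 1 1 1 = -l := by linarith
    have hl0 : l ≠ 0 := by grind
    rw [f111] at s1 hk hu
    obtain rfl : s = 6 * l ^ 2 := by linarith
    have f212 : a 2 1 2 = l := by linarith
    have f221 : a 2 2 1 = t / (6 * l) := by grind
    have f122 : a 1 2 2 = l := by grind
    have f021 : a 0 2 1 = 0 := by grind
    have f012 : a 0 1 2 = 0 := by grind
    have hdet := hdet l hl0
    rcases lt_or_gt_of_ne ht with h0 | h0
    · obtain rfl : t = -(2 * m ^ 2) := by rw [hm2, abs_of_neg h0, neg_neg]
      refine isModel3_of_matrix 3 _ hdet ?_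
      rw [models3_three]
      simp [Fin.forall_fin_succ, Fin.sum_univ_three, h.form_zero_zero, h.form_zero_one,
        h.form_zero_two, h.form_one_zero, h.form_one_one, h.form_one_two, h.form_two_zero,
        h.form_two_one, h.form_two_two, h.zero_zero_one, h.zero_zero_two, f101, f202, h12, h21,
        f011, f022, f111, f212, f121, f222, f211, f112, f012, f021, f221, f122]
      grind
    · obtain rfl : t = 2 * m ^ 2 := by rw [hm2, abs_of_pos h0]
      refine isModel3_of_matrix 2 _ hdet ?_
      rw [models3_two]
      simp [Fin.forall_fin_succ, Fin.sum_univ_three, h.form_zero_zero, h.form_zero_one,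
        h.form_zero_two, h.form_one_zero, h.form_one_one, h.form_one_two, h.form_two_zero,
        h.form_two_one, h.form_two_two, h.zero_zero_one, h.zero_zero_two, f101, f202, h12, h21,
        f011, f022, f111, f212, f121, f222, f211, f112, f012, f021, f221, f122]
      grind
  · obtain ⟨l, hl⟩ : ∃ l, l = a 1 1 1 / 2 := ⟨_, rfl⟩
    have f111 : a 1 1 1 = 2 * l := by linarith
    have hl0 : l ≠ 0 := by grind
    rw [f111] at s1 hk hu
    obtain rfl : s = 24 * l ^ 2 := by linarith
    have f212 : a 2 1 2 = -2 * l := by linarith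
    have f221 : a 2 2 1 = t / (6 * l) := by grind
    have f122 : a 1 2 2 = l := by grind
    have f021 : a 0 2 1 = 0 := by grind
    have f012 : a 0 1 2 = 0 := by grind
    have hdet := hdet l hl0
    rcases lt_or_gt_of_ne ht with h0 | h0
    · obtain rfl : t = -(2 * m ^ 2) := by rw [hm2, abs_of_neg h0, neg_neg]
      refine isModel3_of_matrix 4 _ hdet ?_
      rw [models3_four]
      simp [Fin.forall_fin_succ, Fin.sum_univ_three, h.form_zero_zero, h.form_zero_one,
        h.form_zero_two, h.form_one_zero, h.form_one_one, h.form_one_two, h.form_two_zero,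
        h.form_two_one, h.form_two_two, h.zero_zero_one, h.zero_zero_two, f101, f202, h12, h21,
        f011, f022, f111, f212, f121, f222, f211, f112, f012, f021, f221, f122]
      grind
    · obtain rfl : t = 2 * m ^ 2 := by rw [hm2, abs_of_pos h0]
      refine isModel3_of_matrix 5 _ hdet ?_
      rw [models3_five]
      simp [Fin.forall_fin_succ, Fin.sum_univ_three, h.form_zero_zero, h.form_zero_one,
        h.form_zero_two, h.form_one_zero, h.form_one_one, h.form_one_two, h.form_two_zero,
        h.form_two_one, h.form_two_two, h.zero_zero_one, h.zero_zero_two, f101, f202, h12, h21,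
        f011, f022, f111, f212, f121, f222, f211, f112, f012, f021, f221, f122]
      grind

end IsDiagonalFrame

/-- Classification of 3-dimensional differentially non-degenerate LSAs: every such
algebra is isomorphic to one of the eight algebras whose right-adjoint operators are
the listed linear Nijenhuis operators, and conversely each of the eight operator
fields is a Nijenhuis operator and is the right-adjoint operator of a differentially
non-degenerate LSA. -/
theorem stmt7 :
    (∀ a : Fin 3 → Fin 3 → Fin 3 → ℝ, IsLSA a → DiffNonDeg a →
      ∃ m : Fin 8, AlgIsoSC a (scOfOp (models3 m))) ∧
    (∀ m : Fin 8, IsNijenhuis (models3 m) ∧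
      ∃ a : Fin 3 → Fin 3 → Fin 3 → ℝ,
        IsLSA a ∧ DiffNonDeg a ∧ rightAdj a = models3 m) := by
  refine ⟨fun a hL hN => ?_, fun m => ⟨rightAdj_scOfOp_models3 m ▸
    (isLSA_scOfOp_models3 m).isNijenhuis_rightAdj, _, isLSA_scOfOp_models3 m,
    diffNonDeg_scOfOp_models3 m, rightAdj_scOfOp_models3 m⟩⟩
  obtain ⟨b, hb, hba⟩ := exists_isTraceNormal hL hN
  obtain ⟨c, hc, hcb, h12, h01, h02⟩ := hb.exists_form_diagonal
  have hd := hc.isDiagonalFrame h12 h01 h02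
  refine hba (hcb ?_)
  by_cases hα : c 0 0 0 = 1 / 2
  · rw [hα] at hd
    obtain ⟨d, s, t, hd', hdc, h11, h22, h21, h12⟩ := hd.exists_block_half
    exact hdc (hd'.isModel3_of_block_half h11 h22 h21 h12)
  · obtain ⟨d, hdc, ⟨s, t, hd', h11, h22, h21, h12, h211⟩ | ⟨hd', h11, h22, h21, hν⟩⟩ :=
      hd.exists_reduced_frame hα
    · refine hdc (hd'.isModel3_of_scalar ?_ h11 h22 h21 h12 h211)
      have := hd.form_zero_zero_cases
      tauto
    · exact hdc (hd'.isModel3 hα h11 h22 h21 hν)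
end

section
/- The linear operator field L(x,y,z) = [[2x,−y,0],[y,0,0],[0,0,z]] on ℝ³ is a Nijenhuis operator; the coefficients of its characteristic polynomial are σ₁ = −2x−z, σ₂ = y²+2xz, σ₃ = −y²z, and these three polynomials are algebraically independent over ℝ. Consequently the algebra 𝔟₄⁺⊕𝔡 with relations η₁⋆η₁ = 2η₁, η₁⋆η₂ = η₂, η₂⋆η₂ = −η₁, η₃⋆η₃ = η₃ (other products zero) is a differentially non-degenerate LSA. -/
open Matrix

/-- The operator field of the 𝔟₄⁺⊕𝔡. -/
def Lop (x : Fin 3 → ℝ) : Matrix (Fin 3) (Fin 3) ℝ :=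
  Matrix.of ![![2 * x 0, -x 1, 0], ![x 1, 0, 0], ![0, 0, x 2]]

/-- Structure constants of the 𝔟₄⁺⊕𝔡. -/
def sc : Fin 3 → Fin 3 → Fin 3 → ℝ :=
  ![![![2,0,0], ![0,1,0], ![0,0,0]],
    ![![0,0,0], ![-1,0,0], ![0,0,0]],
    ![![0,0,0], ![0,0,0], ![0,0,1]]]

/-- A family of real functions whose joint range contains a product of infinite sets is
algebraically independent. -/
theorem algebraicIndependent_of_pi_subset_range {ι X : Type*} [Finite ι] (f : ι → X → ℝ)
    (S : ι → Set ℝ) (hS : ∀ i, (S i).Infinite)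
    (h : ∀ v ∈ Set.pi Set.univ S, ∃ x, ∀ i, f i x = v i) : AlgebraicIndependent ℝ f := by
  rw [algebraicIndependent_iff]
  intro p hp
  refine MvPolynomial.funext_set S hS fun v hv => ?_
  obtain ⟨x, hx⟩ := h v hv
  have hpx : MvPolynomial.aeval (fun i => f i x) p = 0 := by
    have := congrArg (Pi.evalAlgHom ℝ (fun _ : X => ℝ) x) hp
    rw [map_zero, ← AlgHom.comp_apply, MvPolynomial.comp_aeval] at this
    exact this
  rw [funext hx] at hpx
  simpa [MvPolynomial.aeval_eq_eval] using hpx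

/-- A monic real cubic with negative constant term has a positive root. -/
theorem exists_pos_root_cubic (u v w : ℝ) (hw : w < 0) :
    ∃ z : ℝ, 0 < z ∧ z ^ 3 + u * z ^ 2 + v * z + w = 0 := by
  obtain ⟨M, hM⟩ : ∃ M, M = 1 + |u| + |v| + |w| := ⟨_, rfl⟩
  have hu := abs_nonneg u
  have hv := abs_nonneg v
  have hw' := abs_nonneg w
  have hM1 : 1 ≤ M := by linarith
  have hMM : M ≤ M ^ 2 := by nlinarith
  have h1 : -|u| * M ^ 2 ≤ u * M ^ 2 :=
    mul_le_mul_of_nonneg_right (neg_abs_le u) (by positivity)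
  have h2 : -|v| * M ^ 2 ≤ v * M := by
    have := mul_le_mul_of_nonneg_right (neg_abs_le v) (by linarith : 0 ≤ M)
    nlinarith
  have h3 : -|w| * M ^ 2 ≤ w := by
    have := neg_abs_le w
    nlinarith
  have h4 : M ^ 3 = M ^ 2 + |u| * M ^ 2 + |v| * M ^ 2 + |w| * M ^ 2 := by
    rw [pow_succ M 2]; nth_rewrite 2 [hM]; ring
  have hpos : 0 ≤ M ^ 3 + u * M ^ 2 + v * M + w := by nlinarith
  have hcont : ContinuousOn (fun z : ℝ => z ^ 3 + u * z ^ 2 + v * z + w) (Set.Icc 0 M) := by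
    fun_prop
  obtain ⟨z, hz, hz0⟩ := intermediate_value_Icc (by linarith : (0 : ℝ) ≤ M) hcont
    (show (0 : ℝ) ∈ Set.Icc _ _ from ⟨by simpa using hw.le, hpos⟩)
  refine ⟨z, lt_of_le_of_ne hz.1 ?_, hz0⟩
  rintro rfl
  simp at hz0
  exact hw.ne hz0

theorem algebraicIndependent_charCoeff_formulas :
    AlgebraicIndependent ℝ
      ![(fun x : Fin 3 → ℝ => -2 * x 0 - x 2),
        (fun x : Fin 3 → ℝ => x 1 ^ 2 + 2 * x 0 * x 2),
        (fun x : Fin 3 → ℝ => -(x 1 ^ 2 * x 2))] := by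
  refine algebraicIndependent_of_pi_subset_range _ ![Set.univ, Set.univ, Set.Iio 0] ?_ ?_
  · intro i
    fin_cases i
    · exact Set.infinite_univ
    · exact Set.infinite_univ
    · exact Set.Iio_infinite 0
  · intro s hs
    have hs2 : s 2 < 0 := hs 2 (Set.mem_univ _)
    obtain ⟨z, hz, hroot⟩ := exists_pos_root_cubic (s 0) (s 1) (s 2) hs2
    have hy : √(-s 2 / z) ^ 2 = -s 2 / z :=
      Real.sq_sqrt (div_nonneg (by linarith) hz.le)
    refine ⟨![(-s 0 - z) / 2, √(-s 2 / z), z], fun i => ?_⟩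
    fin_cases i
    · simp; ring
    · simp [hy]; field_simp; linarith
    · simp [hy]; field_simp

theorem isNijenhuis_Lop : IsNijenhuis Lop := by
  have hproj : ∀ (i : Fin 3) (x : Fin 3 → ℝ),
      fderiv ℝ (fun y : Fin 3 → ℝ => y i) x = ContinuousLinearMap.proj i :=
    fun i x => (ContinuousLinearMap.proj (R := ℝ) (φ := fun _ : Fin 3 => ℝ) i).fderiv
  have hmul : ∀ x : Fin 3 → ℝ, fderiv ℝ (fun y : Fin 3 → ℝ => 2 * y 0) x
      = (2 : ℝ) • ContinuousLinearMap.proj 0 := by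
    intro x
    rw [fderiv_const_mul (by fun_prop), hproj]
  intro x i j k
  fin_cases i <;> fin_cases j <;> fin_cases k <;>
    simp [nijTorsion, Lop, Fin.sum_univ_three, hproj, hmul, fderiv_fun_neg] <;> ring

theorem charpoly_Lop (x : Fin 3 → ℝ) :
    (Lop x).charpoly = Polynomial.X ^ 3 + Polynomial.C (-2 * x 0 - x 2) * Polynomial.X ^ 2
      + Polynomial.C (x 1 ^ 2 + 2 * x 0 * x 2) * Polynomial.X
      + Polynomial.C (-(x 1 ^ 2 * x 2)) := by
  simp [Matrix.charpoly, Matrix.det_fin_three, Lop]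
  ring

theorem rightAdj_sc : rightAdj sc = Lop := by
  funext x
  ext i j
  fin_cases i <;> fin_cases j <;> simp [rightAdj, sc, Lop, Fin.sum_univ_three]

theorem isLSA_sc : IsLSA sc := by
  intro ξ η ζ
  funext k
  fin_cases k <;> simp [mulSC, sc, Fin.sum_univ_three] <;> ring

theorem charCoeff_Lop : charCoeff Lop =
    ![(fun x : Fin 3 → ℝ => -2 * x 0 - x 2),
      (fun x : Fin 3 → ℝ => x 1 ^ 2 + 2 * x 0 * x 2),
      (fun x : Fin 3 → ℝ => -(x 1 ^ 2 * x 2))] := by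
  funext i x
  rw [charCoeff, charpoly_Lop]
  fin_cases i <;>
    simp only [Polynomial.coeff_add, Polynomial.coeff_C_mul, Polynomial.coeff_X_pow,
      Polynomial.coeff_X, Polynomial.coeff_C] <;> simp

/-- The operator field is a Nijenhuis operator; the coefficients of its
characteristic polynomial are the stated polynomials, which are algebraically
independent over `ℝ`; it is the right-adjoint operator of the stated algebra,
which is consequently a differentially non-degenerate LSA. -/
theorem stmt8 :
    IsNijenhuis Lop ∧
    (∀ x : Fin 3 → ℝ, charCoeff Lop 0 x = -2 * x 0 - x 2) ∧
    (∀ x : Fin 3 → ℝ, charCoeff Lop 1 x = x 1 ^ 2 + 2 * x 0 * x 2) ∧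
    (∀ x : Fin 3 → ℝ, charCoeff Lop 2 x = -(x 1 ^ 2 * x 2)) ∧
    AlgebraicIndependent ℝ
      ![(fun x : Fin 3 → ℝ => -2 * x 0 - x 2),
        (fun x : Fin 3 → ℝ => x 1 ^ 2 + 2 * x 0 * x 2),
        (fun x : Fin 3 → ℝ => -(x 1 ^ 2 * x 2))] ∧
    rightAdj sc = Lop ∧ IsLSA sc ∧ DiffNonDeg sc := by
  exact ⟨isNijenhuis_Lop, congrFun (congrFun charCoeff_Lop 0), congrFun (congrFun charCoeff_Lop 1),
    congrFun (congrFun charCoeff_Lop 2), algebraicIndependent_charCoeff_formulas, rightAdj_sc,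
    isLSA_sc, by
      rw [DiffNonDeg, rightAdj_sc, charCoeff_Lop]
      exact algebraicIndependent_charCoeff_formulas⟩
end
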